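/- arXiv:1912.08461 — 4 statements merged into one kernel-verified Lean document; each statement's English description precedes it below -/
import Mathlib

section
/- Let e≥2, s∈𝒜̄^l_e and t=s_1+…+s_l. For every l-partition 𝛌, the block weights agree under the Uglov map: p_{(e,s)}(𝛌) = p_{(e,(t))}(τ_{e,s}(𝛌)). -/
noncomputable section

/-- A partition: a nonincreasing sequence of nonnegative integers with finitely many
nonzero terms. `parts j` is the `(j+1)`-st part `λ_{j+1}` (0-indexed). -/
structure Ptn where
  parts : ℕ → ℕ
  antitone' : ∀ ⦃i j : ℕ⦄, i ≤ j → parts j ≤ parts i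
  eventually_zero : ∃ N, ∀ n, N ≤ n → parts n = 0

/-- The empty partition. -/
def Ptn.empty : Ptn := ⟨fun _ => 0, fun _ _ _ => le_rfl, ⟨0, fun _ _ => rfl⟩⟩

/-- The abacus `L_s(λ) = {λ_j − j + s : j ∈ ℤ_{>0}}` of a partition with charge `s`. -/
def abacus (s : ℤ) (lam : Ptn) : Set ℤ :=
  {x | ∃ j : ℕ, x = (lam.parts j : ℤ) - ((j : ℤ) + 1) + s}

/-- The Young diagram of an `l`-partition, with 0-indexed rows and columns:
`(a, b, c) ∈ diag 𝛌` represents the node in row `a+1`, column `b+1` of component `c`. -/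
def diag {l : ℕ} (lam : Fin l → Ptn) : Set (ℕ × ℕ × Fin l) :=
  {x | x.2.1 < (lam x.2.2).parts x.1}

/-- The rank of an `l`-partition: the number of nodes of its Young diagram. -/
def rank {l : ℕ} (lam : Fin l → Ptn) : ℕ := (diag lam).ncard

/-- The rank of a partition. -/
def rank₁ (lam : Ptn) : ℕ := rank (fun _ : Fin 1 => lam)

/-- The residue of the node `(a,b,c)` (0-indexed), i.e. `(b+1) − (a+1) + s_c mod e`. -/
def res (e : ℕ) {l : ℕ} (s : Fin l → ℤ) (x : ℕ × ℕ × Fin l) : ZMod e :=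
  (((x.2.1 : ℤ) - (x.1 : ℤ) + s x.2.2 : ℤ) : ZMod e)

/-- `c^{e,s}_i(𝛌)`: the number of nodes of `𝛌` of residue `i`. -/
def resCount (e : ℕ) {l : ℕ} (s : Fin l → ℤ) (lam : Fin l → Ptn) (i : ZMod e) : ℕ :=
  {x ∈ diag lam | res e s x = i}.ncard

/-- `c^{e,(t)}_i(λ)` for a single partition with charge `t`. -/
def resCount₁ (e : ℕ) (t : ℤ) (lam : Ptn) (i : ZMod e) : ℕ :=
  resCount e (fun _ : Fin 1 => t) (fun _ => lam) i

/-- A node `γ` of `𝛌` is removable if deleting it yields the Young diagram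
of an `l`-partition. -/
def Removable {l : ℕ} (lam : Fin l → Ptn) (γ : ℕ × ℕ × Fin l) : Prop :=
  γ ∈ diag lam ∧ ∃ mu : Fin l → Ptn, diag mu = diag lam \ {γ}

/-- A node `γ ∉ [𝛌]` is addable for `𝛌` if adding it yields the Young diagram
of an `l`-partition. -/
def Addable {l : ℕ} (lam : Fin l → Ptn) (γ : ℕ × ℕ × Fin l) : Prop :=
  γ ∉ diag lam ∧ ∃ mu : Fin l → Ptn, diag mu = diag lam ∪ {γ}

/-- `M^s_i(𝛌)`: the number of addable nodes of residue `i` minus the number of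
removable nodes of residue `i`. -/
def Mnum (e : ℕ) {l : ℕ} (s : Fin l → ℤ) (lam : Fin l → Ptn) (i : ZMod e) : ℤ :=
  ({γ | Addable lam γ ∧ res e s γ = i}.ncard : ℤ) -
    ({γ | Removable lam γ ∧ res e s γ = i}.ncard : ℤ)

/-- `M^{(t)}_i(λ)` for a single partition with charge `t`. -/
def Mnum₁ (e : ℕ) (t : ℤ) (lam : Ptn) (i : ZMod e) : ℤ :=
  Mnum e (fun _ : Fin 1 => t) (fun _ => lam) i

/-- The block `(e,s)`-weight of Fayers:
`p_{(e,s)}(𝛌) = Σ_{i=1}^{l} c_{s_i}(𝛌) − (1/2) Σ_{i ∈ ℤ/eℤ} (c_i(𝛌) − c_{i−1}(𝛌))²`. -/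
def blockWeight (e : ℕ) {l : ℕ} (s : Fin l → ℤ) (lam : Fin l → Ptn) : ℚ :=
  (∑ i : Fin l, (resCount e s lam ((s i : ZMod e)) : ℚ)) -
    (1 / 2) * ∑ i ∈ Finset.range e,
      ((resCount e s lam ((i : ZMod e)) : ℚ) - (resCount e s lam ((i : ZMod e) - 1) : ℚ)) ^ 2

/-- Block weight of a single partition with charge `t`. -/
def blockWeight₁ (e : ℕ) (t : ℤ) (lam : Ptn) : ℚ :=
  blockWeight e (fun _ : Fin 1 => t) (fun _ => lam)

/-- The `l`-abacus `(L_{s_1}(λ^1),…,L_{s_l}(λ^l))` is `(e,s)`-complete: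
`L_{s_1}(λ^1) ⊆ … ⊆ L_{s_l}(λ^l) ⊆ {x+e : x ∈ L_{s_1}(λ^1)}`. -/
def Complete (e : ℕ) {l : ℕ} (s : Fin l → ℤ) (lam : Fin l → Ptn) : Prop :=
  (∀ i j : Fin l, (j : ℕ) = (i : ℕ) + 1 →
      abacus (s i) (lam i) ⊆ abacus (s j) (lam j)) ∧
  (∀ i j : Fin l, (i : ℕ) = l - 1 → (j : ℕ) = 0 →
      abacus (s i) (lam i) ⊆ {x | x - (e : ℤ) ∈ abacus (s j) (lam j)})

/-- `𝒜̄^l_e = {s ∈ ℤ^l : 0 ≤ s_j − s_i ≤ e for all i < j}`. -/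
def Abar (e : ℕ) {l : ℕ} (s : Fin l → ℤ) : Prop :=
  ∀ i j : Fin l, i < j → 0 ≤ s j - s i ∧ s j - s i ≤ (e : ℤ)

/-- `𝒜^l_e = {s ∈ ℤ^l : 0 ≤ s_j − s_i < e for all i < j}`. -/
def Aset (e : ℕ) {l : ℕ} (s : Fin l → ℤ) : Prop :=
  ∀ i j : Fin l, i < j → 0 ≤ s j - s i ∧ s j - s i < (e : ℤ)

/-- A partition is an `e`-core if its abacus is stable under subtracting `e`
(a condition independent of the charge). -/
def IsECore (e : ℕ) (lam : Ptn) : Prop :=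
  ∀ x ∈ abacus 0 lam, x - (e : ℤ) ∈ abacus 0 lam

/-- The permutation `σ_s`: the unique permutation sorting the residues
`s'_i = s_i mod e ∈ {0,…,e−1}` increasingly and stably. -/
def sigmaPerm (e : ℕ) {l : ℕ} (s : Fin l → ℤ) : Equiv.Perm (Fin l) :=
  Tuple.sort (fun i => s i % (e : ℤ))

/-- `𝛌` is an `(e,s)`-core if `𝛌^{σ_s}` is a reduced `(e, s̃^{σ_s})`-core. -/
def IsCore (e : ℕ) {l : ℕ} (s : Fin l → ℤ) (lam : Fin l → Ptn) : Prop :=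
  Complete e (fun i => s (sigmaPerm e s i) % (e : ℤ)) (fun i => lam (sigmaPerm e s i))

/-- The set `{(l−c)e + q·e·l + r : 1 ≤ c ≤ l, q ∈ ℤ, 0 ≤ r ≤ e−1, qe+r ∈ L_{s_c}(λ^c)}`
(with `c = (c' : Fin l) + 1`). -/
def uglovSet (e : ℕ) {l : ℕ} (s : Fin l → ℤ) (lam : Fin l → Ptn) : Set ℤ :=
  {y | ∃ (c : Fin l) (q : ℤ) (r : ℕ), r < e ∧
      (q * (e : ℤ) + (r : ℤ)) ∈ abacus (s c) (lam c) ∧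
      y = ((l : ℤ) - 1 - ((c : ℕ) : ℤ)) * (e : ℤ) + q * (e : ℤ) * (l : ℤ) + (r : ℤ)}

/-- `μ = τ_{e,s}(𝛌)`: the Uglov map sends `𝛌` to the unique partition `μ` whose abacus
with charge `t = s_1 + … + s_l` is the Uglov set of `(𝛌,s)`. -/
def IsUglov (e : ℕ) {l : ℕ} (s : Fin l → ℤ) (lam : Fin l → Ptn) (mu : Ptn) : Prop :=
  abacus (∑ i, s i) mu = uglovSet e s lam

/-- An elementary operation on a pair (`l`-partition, multicharge), performed on the
associated `l`-abacus. -/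
def ElemOp (e : ℕ) {l : ℕ} (p q : (Fin l → Ptn) × (Fin l → ℤ)) : Prop :=
  (∃ (i j : Fin l) (x : ℤ), (j : ℕ) = (i : ℕ) + 1 ∧
      x ∈ abacus (p.2 i) (p.1 i) ∧ x ∉ abacus (p.2 j) (p.1 j) ∧
      abacus (q.2 i) (q.1 i) = abacus (p.2 i) (p.1 i) \ {x} ∧
      abacus (q.2 j) (q.1 j) = abacus (p.2 j) (p.1 j) ∪ {x} ∧
      q.2 i = p.2 i - 1 ∧ q.2 j = p.2 j + 1 ∧
      (∀ k, k ≠ i → k ≠ j → q.1 k = p.1 k ∧ q.2 k = p.2 k)) ∨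
  (∃ (i j : Fin l) (x : ℤ), (i : ℕ) = l - 1 ∧ (j : ℕ) = 0 ∧
      x ∈ abacus (p.2 i) (p.1 i) ∧ x - (e : ℤ) ∉ abacus (p.2 j) (p.1 j) ∧
      (i = j → abacus (q.2 i) (q.1 i) = (abacus (p.2 i) (p.1 i) \ {x}) ∪ {x - (e : ℤ)} ∧
        q.2 i = p.2 i) ∧
      (i ≠ j → abacus (q.2 i) (q.1 i) = abacus (p.2 i) (p.1 i) \ {x} ∧
        abacus (q.2 j) (q.1 j) = abacus (p.2 j) (p.1 j) ∪ {x - (e : ℤ)} ∧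
        q.2 i = p.2 i - 1 ∧ q.2 j = p.2 j + 1) ∧
      (∀ k, k ≠ i → k ≠ j → q.1 k = p.1 k ∧ q.2 k = p.2 k))

/-- A sequence of `n` elementary operations starting from `p`. -/
def OpSeq (e : ℕ) {l : ℕ} (p : (Fin l → Ptn) × (Fin l → ℤ))
    (f : ℕ → (Fin l → Ptn) × (Fin l → ℤ)) (n : ℕ) : Prop :=
  f 0 = p ∧ ∀ k < n, ElemOp e (f k) (f (k + 1))

/-- A maximal sequence of elementary operations: performed until the resulting
`l`-abacus is complete for the current multicharge. -/
def MaxOpSeq (e : ℕ) {l : ℕ} (p : (Fin l → Ptn) × (Fin l → ℤ))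
    (f : ℕ → (Fin l → Ptn) × (Fin l → ℤ)) (n : ℕ) : Prop :=
  OpSeq e p f n ∧ Complete e (f n).2 (f n).1

/-- `q` is the core of the pair `p`: it is reached from `p` by a maximal sequence
of elementary operations. -/
def IsCorePairOf (e : ℕ) {l : ℕ} (p q : (Fin l → Ptn) × (Fin l → ℤ)) : Prop :=
  ∃ f n, MaxOpSeq e p f n ∧ f n = q

/-- `κ = Core_e(λ)`: on abaci, the abacus of `κ` is obtained from that of `λ` by
repeatedly replacing an element `y` with `y − e ∉ L` by `y − e`, until no such
replacement is possible. -/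
def IsECoreOf (e : ℕ) (kappa lam : Ptn) : Prop :=
  IsECore e kappa ∧ ∃ (f : ℕ → Ptn) (m : ℕ), f 0 = lam ∧ f m = kappa ∧
    ∀ k < m, ∃ y ∈ abacus 0 (f k), y - (e : ℤ) ∉ abacus 0 (f k) ∧
      abacus 0 (f (k + 1)) = (abacus 0 (f k) \ {y}) ∪ {y - (e : ℤ)}

end

open Finset in
theorem sum_shift (e : ℕ) (he : 0 < e) (F : ℤ → ℤ) (hF : F (-1) = F ((e:ℤ) - 1)) :
    ∑ i ∈ Finset.range e, F ((i:ℤ) - 1) = ∑ i ∈ Finset.range e, F (i:ℤ) := by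
  obtain ⟨k, rfl⟩ : ∃ k, e = k + 1 := ⟨e - 1, by omega⟩
  rw [Finset.sum_range_succ', Finset.sum_range_succ]
  push_cast at hF ⊢
  simp at hF ⊢
  exact hF

theorem ediv_step (e : ℤ) (he : 0 < e) (x : ℤ) :
    x / e - (x - 1) / e = if e ∣ x then 1 else 0 := by
  split_ifs with h
  · obtain ⟨k, rfl⟩ := h
    have h1 : (e * k) / e = k := Int.mul_ediv_cancel_left _ he.ne'
    have h2 : (e * k - 1) / e = k - 1 := by
      rw [Int.ediv_eq_iff_of_pos he]
      constructor <;> nlinarith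
    rw [h1, h2]; ring
  · have h3 : x % e ≠ 0 := fun h' => h (Int.dvd_of_emod_eq_zero h')
    have h4 := Int.emod_nonneg x he.ne'
    have h5 := Int.emod_lt_of_pos x he
    have h6 := Int.emod_add_mul_ediv x e
    have h2 : (x - 1) / e = x / e := by
      rw [Int.ediv_eq_iff_of_pos he]
      have : 1 ≤ x % e := by omega
      constructor <;> nlinarith
    rw [h2]; ring

theorem count_row (e : ℕ) (he : 0 < e) (w : ℤ) (n : ℕ) :
    (((Finset.range n).filter (fun b : ℕ => (((b:ℤ) + w : ℤ) : ZMod e) = 0)).card : ℤ)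
      = ((n:ℤ) - 1 + w) / e - (w - 1) / e := by
  induction n with
  | zero => simp [sub_eq_add_neg, add_comm]
  | succ n ih =>
    rw [Finset.range_add_one, Finset.filter_insert]
    have hs := ediv_step e (by exact_mod_cast he) ((n:ℤ) + w)
    have e1 : (n:ℤ) + w - 1 = n - 1 + w := by ring
    rw [e1] at hs
    have e2 : ((n+1:ℕ):ℤ) - 1 + w = n + w := by push_cast; ring
    rw [e2]
    have hd : (((n:ℤ) + w : ℤ) : ZMod e) = 0 ↔ (e:ℤ) ∣ (n:ℤ) + w :=
      ZMod.intCast_zmod_eq_zero_iff_dvd _ _ |> fun h => h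
    by_cases h : (e:ℤ) ∣ (n:ℤ) + w
    · rw [if_pos (hd.2 h), Finset.card_insert_of_notMem (by simp)]
      rw [if_pos h] at hs
      rw [Nat.cast_add, ih, Nat.cast_one]; linarith
    · rw [if_neg (fun h' => h (hd.1 h'))]
      rw [if_neg h] at hs
      rw [ih]; linarith

/-- bead positions -/
def bead (s : ℤ) (lam : Ptn) (j : ℕ) : ℤ := (lam.parts j : ℤ) - ((j : ℤ) + 1) + s

theorem bead_inj (s : ℤ) (lam : Ptn) : Function.Injective (bead s lam) := by
  have : StrictAnti (bead s lam) := by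
    intro i j hij
    have := lam.antitone' hij.le
    unfold bead
    omega
  exact this.injective

/-- beads at or above the base `-A` -/
def BX (A s : ℤ) (lam : Ptn) : Finset ℤ := (Finset.range (s + A).toNat).image (bead s lam)

/-- the base is low enough -/
def Good (A s : ℤ) (lam : Ptn) : Prop := 0 ≤ s + A ∧ ∀ n : ℕ, s + A ≤ n → lam.parts n = 0

theorem mem_BX {A s : ℤ} {lam : Ptn} (h : Good A s lam) (x : ℤ) :
    x ∈ BX A s lam ↔ x ∈ abacus s lam ∧ -A ≤ x := by
  obtain ⟨h0, h1⟩ := h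
  simp only [BX, Finset.mem_image, Finset.mem_range, abacus, Set.mem_ofPred_eq]
  constructor
  · rintro ⟨j, hj, rfl⟩
    refine ⟨⟨j, rfl⟩, ?_⟩
    unfold bead; omega
  · rintro ⟨⟨j, rfl⟩, hA⟩
    refine ⟨j, ?_, rfl⟩
    by_contra hc
    have := h1 j (by omega)
    omega

theorem sum_BX (A s : ℤ) (lam : Ptn) (f : ℤ → ℤ) :
    ∑ x ∈ BX A s lam, f x = ∑ j ∈ Finset.range (s + A).toNat, f (bead s lam j) :=
  Finset.sum_image (fun _ _ _ _ h => bead_inj s lam h)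

theorem card_BX (A s : ℤ) (lam : Ptn) : (BX A s lam).card = (s + A).toNat := by
  rw [BX, Finset.card_image_of_injective _ (bead_inj s lam), Finset.card_range]

theorem sum_base (A s : ℤ) (f : ℤ → ℤ) :
    ∑ x ∈ Finset.Ico (-A) s, f x = ∑ j ∈ Finset.range (s + A).toNat, f (s - (j + 1)) := by
  symm
  refine Finset.sum_nbij' (fun j : ℕ => s - ((j:ℤ) + 1)) (fun x => (s - 1 - x).toNat) ?_ ?_ ?_ ?_ ?_
  · intro j hj; simp only [Finset.mem_range, Finset.mem_Ico] at *; omega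
  · intro j hj; simp only [Finset.mem_range, Finset.mem_Ico] at *; omega
  · intro j hj; simp only [Finset.mem_range] at *; omega
  · intro j hj; simp only [Finset.mem_Ico] at *; omega
  · intro j hj; rfl

theorem resCount_eq (e : ℕ) (he : 0 < e) {l : ℕ} (A : ℤ) (s : Fin l → ℤ) (lam : Fin l → Ptn)
    (hg : ∀ c, Good A (s c) (lam c)) (r : ℤ) :
    (resCount e s lam (r : ZMod e) : ℤ) =
      ∑ c, (∑ x ∈ BX A (s c) (lam c), (x - r) / e - ∑ x ∈ Finset.Ico (-A) (s c), (x - r) / e) := by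
  classical
  have hset : {x ∈ diag lam | res e s x = (r : ZMod e)} =
      ↑((Finset.univ : Finset (Fin l)).biUnion (fun c =>
        (Finset.range (s c + A).toNat).biUnion (fun a =>
          ((Finset.range ((lam c).parts a)).filter
            (fun b : ℕ => (((b:ℤ) + (s c - a - r) : ℤ) : ZMod e) = 0)).image
              (fun b => (a, b, c))))) := by
    ext ⟨a, b, c⟩
    simp only [diag, res, Set.mem_ofPred_eq, Finset.coe_biUnion, Finset.mem_coe, Finset.mem_univ,
      Set.iUnion_true, Set.mem_iUnion, Finset.mem_range, Finset.coe_image, Set.mem_image,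
      Finset.coe_filter, Prod.mk.injEq, exists_prop]
    have key : (((b:ℤ) - a + s c : ℤ) : ZMod e) = (r : ZMod e) ↔
        (((b:ℤ) + (s c - a - r) : ℤ) : ZMod e) = 0 := by
      rw [← sub_eq_zero]
      push_cast
      constructor <;> intro h <;> rw [← h] <;> ring
    constructor
    · rintro ⟨h1, h2⟩
      refine ⟨c, a, ?_, b, ⟨h1, key.1 h2⟩, rfl, rfl, rfl⟩
      by_contra hc
      have := (hg c).2 a (by omega)
      omega
    · rintro ⟨c', a', h1, b', ⟨h2, h3⟩, rfl, rfl, rfl⟩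
      exact ⟨h2, key.2 h3⟩
  rw [resCount, hset, Set.ncard_coe_finset, Finset.card_biUnion]
  · rw [Nat.cast_sum]
    refine Finset.sum_congr rfl (fun c _ => ?_)
    rw [Finset.card_biUnion]
    · rw [sum_BX A (s c) (lam c) (fun x => (x - r) / e), sum_base A (s c) (fun x => (x - r) / e),
        ← Finset.sum_sub_distrib, Nat.cast_sum]
      refine Finset.sum_congr rfl (fun a _ => ?_)
      rw [Finset.card_image_of_injective _ (fun b b' h => by simpa using h), count_row e he]
      unfold bead
      congr 2 <;> ring
    · intro a _ a' _ haa
      rw [Function.onFun, Finset.disjoint_left]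
      rintro x hx hx'
      simp only [Finset.mem_image] at hx hx'
      obtain ⟨b, _, rfl⟩ := hx
      obtain ⟨b', _, h⟩ := hx'
      simp at h; exact haa h.1.symm
  · intro c _ c' _ hcc
    rw [Function.onFun, Finset.disjoint_left]
    rintro x hx hx'
    simp only [Finset.mem_biUnion, Finset.mem_image] at hx hx'
    obtain ⟨a, _, b, _, rfl⟩ := hx
    obtain ⟨a', _, b', _, h⟩ := hx'
    simp at h; exact hcc h.2.2.symm

/-- number of elements of a finset in class `i` mod `e` -/
def cls (e : ℕ) (X : Finset ℤ) (i : ℤ) : ℤ := ∑ x ∈ X, if (e:ℤ) ∣ x - i then 1 else 0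

theorem blockWeight_eq (e : ℕ) (he : 0 < e) {l : ℕ} (A : ℤ) (s : Fin l → ℤ) (lam : Fin l → Ptn)
    (hg : ∀ c, Good A (s c) (lam c)) :
    2 * blockWeight e s lam = ((2 * ∑ c, (∑ x ∈ BX A (s c) (lam c), ∑ j, (x - s j) / (e:ℤ) -
      ∑ x ∈ Finset.Ico (-A) (s c), ∑ j, (x - s j) / (e:ℤ)) -
      ∑ i ∈ Finset.range e, (∑ c, (cls e (BX A (s c) (lam c)) i -
        cls e (Finset.Ico (-A) (s c)) i)) ^ 2 : ℤ) : ℚ) := by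
  have h1 : ∑ i : Fin l, (resCount e s lam ((s i : ZMod e)) : ℤ) =
      ∑ c, (∑ x ∈ BX A (s c) (lam c), ∑ j, (x - s j) / (e:ℤ) -
      ∑ x ∈ Finset.Ico (-A) (s c), ∑ j, (x - s j) / (e:ℤ)) := by
    rw [Finset.sum_congr rfl (fun i _ => resCount_eq e he A s lam hg (s i)), Finset.sum_comm]
    refine Finset.sum_congr rfl (fun c _ => ?_)
    rw [Finset.sum_sub_distrib, Finset.sum_comm, Finset.sum_comm (s := Finset.univ)]
  have h2 : ∑ i ∈ Finset.range e,
      ((resCount e s lam ((i : ZMod e)) : ℤ) - (resCount e s lam ((i : ZMod e) - 1) : ℤ)) ^ 2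
      = ∑ i ∈ Finset.range e, (∑ c, (cls e (BX A (s c) (lam c)) i -
        cls e (Finset.Ico (-A) (s c)) i)) ^ 2 := by
    rw [← sum_shift e he (fun i => (∑ c, (cls e (BX A (s c) (lam c)) i -
        cls e (Finset.Ico (-A) (s c)) i)) ^ 2)]
    · refine Finset.sum_congr rfl (fun i _ => ?_)
      have e1 : ((i:ZMod e)) = (((i:ℤ)) : ZMod e) := by push_cast; rfl
      have e2 : ((i:ZMod e) - 1) = (((i:ℤ) - 1 : ℤ) : ZMod e) := by push_cast; rfl
      rw [e2, e1, resCount_eq e he A s lam hg, resCount_eq e he A s lam hg, ← Finset.sum_sub_distrib]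
      rw [← neg_sq, ← Finset.sum_neg_distrib]
      have hX : ∀ X : Finset ℤ, cls e X ((i:ℤ) - 1) =
          ∑ x ∈ X, (x - ((i:ℤ) - 1)) / (e:ℤ) - ∑ x ∈ X, (x - (i:ℤ)) / (e:ℤ) := by
        intro X
        rw [cls, ← Finset.sum_sub_distrib]
        refine Finset.sum_congr rfl (fun x _ => ?_)
        rw [← ediv_step e (by exact_mod_cast he)]
        congr 2; ring
      congr 1
      refine Finset.sum_congr rfl (fun c _ => ?_)
      rw [hX, hX]; ring
    · have : ∀ X : Finset ℤ, cls e X (-1) = cls e X ((e:ℤ) - 1) := by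
        intro X
        unfold cls
        refine Finset.sum_congr rfl (fun x _ => ?_)
        have : (e:ℤ) ∣ x - -1 ↔ (e:ℤ) ∣ x - ((e:ℤ) - 1) := by
          have h : x - -1 = (x - ((e:ℤ) - 1)) + e := by ring
          rw [h]; simp
        simp only [this]
      simp only [this]
  rw [← h1, ← h2, blockWeight]
  push_cast
  ring

/-- number of beads of runner `i` below charge `s` -/
def mm (e : ℕ) (s i : ℤ) : ℤ := -((i - s) / (e:ℤ))

theorem lt_mm (e : ℕ) (he : 0 < e) (s i q : ℤ) : q < mm e s i ↔ i + q * e < s := by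
  have he' : (0:ℤ) < e := by exact_mod_cast he
  unfold mm
  rw [lt_neg, Int.ediv_lt_iff_lt_mul he']
  constructor <;> intro h <;> linarith

theorem neg_le_mm (e : ℕ) (he : 0 < e) (K s : ℤ) (hK : 0 ≤ s + K * e) (i : ℕ) (hi : i < e) :
    -K ≤ mm e s i := by
  have : -K - 1 < mm e s i := by
    rw [lt_mm e he]
    have : (i:ℤ) < e := by exact_mod_cast hi
    nlinarith
  omega

theorem sum_class (e : ℕ) (he : 0 < e) (X : Finset ℤ) (F : ℤ → ℤ) :
    ∑ x ∈ X, F x = ∑ i ∈ Finset.range e, ∑ x ∈ X with (e:ℤ) ∣ x - i, F x := by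
  have he' : (0:ℤ) < e := by exact_mod_cast he
  rw [← Finset.sum_fiberwise_of_maps_to (s := X) (t := Finset.range e)
    (g := fun x => (x % (e:ℤ)).toNat)]
  · refine Finset.sum_congr rfl (fun i hi => ?_)
    refine Finset.sum_congr ?_ (fun _ _ => rfl)
    ext x
    simp only [Finset.mem_filter, Finset.mem_range] at *
    refine and_congr_right (fun _ => ?_)
    have h1 := Int.emod_nonneg x he'.ne'
    have h2 := Int.emod_lt_of_pos x he'
    rw [← Int.emod_emod_of_dvd x (dvd_refl (e:ℤ))] at *
    have h3 : (e:ℤ) ∣ x - i ↔ x % e = (i:ℤ) % e := by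
      rw [← Int.emod_eq_emod_iff_emod_sub_eq_zero.trans (Int.dvd_iff_emod_eq_zero).symm]
    rw [h3, Int.emod_eq_of_lt (a := (i:ℤ)) (by omega) (by omega)]
    rw [Int.emod_emod_of_dvd x (dvd_refl (e:ℤ))] at *
    omega
  · intro x _
    have h1 := Int.emod_nonneg x he'.ne'
    have h2 := Int.emod_lt_of_pos x he'
    simp only [Finset.mem_range]
    omega

theorem sum_mod (e : ℕ) (he : 0 < e) (X : Finset ℤ) (H : ℤ → ℤ) :
    ∑ x ∈ X, H (x % e) = ∑ i ∈ Finset.range e, H i * cls e X i := by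
  rw [sum_class e he]
  refine Finset.sum_congr rfl (fun i hi => ?_)
  rw [cls, Finset.mul_sum, Finset.sum_filter]
  refine Finset.sum_congr rfl (fun x _ => ?_)
  split_ifs with h
  · have h3 : x % e = (i:ℤ) % e :=
      (Int.emod_eq_emod_iff_emod_sub_eq_zero.trans (Int.dvd_iff_emod_eq_zero).symm).2 h
    rw [h3, Int.emod_eq_of_lt (a := (i:ℤ)) (by omega) (by simp at hi; omega), mul_one]
  · simp

theorem sum_Ico_class (e : ℕ) (he : 0 < e) (K s : ℤ) (i : ℕ) (hi : i < e)
    (F : ℤ → ℤ) :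
    ∑ x ∈ Finset.Ico (-(K * e)) s with (e:ℤ) ∣ x - i, F x
      = ∑ q ∈ Finset.Ico (-K) (mm e s i), F (i + q * e) := by
  have he' : (0:ℤ) < e := by exact_mod_cast he
  have hi' : (i:ℤ) < e := by exact_mod_cast hi
  symm
  refine Finset.sum_nbij (fun q : ℤ => (i:ℤ) + q * e) ?_ ?_ ?_ ?_
  · intro q hq
    simp only [Finset.mem_Ico, Finset.mem_filter, lt_mm e he] at *
    refine ⟨⟨?_, hq.2⟩, ?_⟩
    · nlinarith
    · simp
  · intro q _ q' _ h
    simp only [add_right_inj] at h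
    exact mul_right_cancel₀ he'.ne' h
  · intro x hx
    simp only [Finset.coe_filter, Finset.mem_Ico, Set.mem_ofPred_eq] at hx
    obtain ⟨⟨h1, h2⟩, k, hk⟩ := hx
    have hx : x = i + k * e := by linarith
    subst hx
    refine ⟨k, ?_, rfl⟩
    simp only [Finset.coe_Ico, Set.mem_Ico, lt_mm e he]
    refine ⟨?_, h2⟩
    by_contra hc
    have : k + 1 ≤ -K := by omega
    nlinarith
  · intro q _; rfl

theorem cls_Ico (e : ℕ) (he : 0 < e) (K s : ℤ) (hK : 0 ≤ s + K * e) (i : ℕ) (hi : i < e) :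
    cls e (Finset.Ico (-(K * e)) s) i = mm e s i + K := by
  rw [cls, ← Finset.sum_filter, sum_Ico_class e he K s i hi]
  have := neg_le_mm e he K s hK i hi
  simp
  omega

theorem sum_Ico_id (K m : ℤ) (h : -K ≤ m) :
    2 * ∑ q ∈ Finset.Ico (-K) m, q = m * (m - 1) - K * (K + 1) := by
  induction m, h using Int.leInduction with
  | base => simp; ring
  | succ m hm ih =>
    rw [← Finset.insert_Ico_right_eq_Ico_add_one hm, Finset.sum_insert (by simp), mul_add, ih]
    ring

theorem sum_mm (e : ℕ) (he : 0 < e) (s : ℤ) :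
    ∑ i ∈ Finset.range e, mm e s i = s := by
  have he' : (0:ℤ) < e := by exact_mod_cast he
  set K : ℤ := |s|
  have hK : 0 ≤ s + K * e := by
    have := neg_abs_le s
    have h2 := abs_nonneg s
    nlinarith
  have h := sum_mod e he (Finset.Ico (-(K * e)) s) (fun _ => 1)
  rw [Finset.sum_congr (s₁ := Finset.range e) rfl (fun i hi => by
    rw [one_mul, cls_Ico e he K s hK i (Finset.mem_range.1 hi)]), Finset.sum_add_distrib] at h
  simp at h
  rw [max_eq_left hK] at h
  linarith

theorem mono01 (l : ℕ) (ε : Fin l → ℤ) (h01 : ∀ i, ε i = 0 ∨ ε i = 1)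
    (hm : ∀ i j, i < j → ε i ≤ ε j) :
    ∑ c : Fin l, 2 * ((l:ℤ) - 1 - ((c:ℕ):ℤ)) * ε c = (∑ c, ε c) ^ 2 - ∑ c, ε c := by
  induction l with
  | zero => simp
  | succ l ih =>
    have ih := ih (fun i => ε i.castSucc) (fun i => h01 _)
      (fun i j h => hm _ _ (by simpa using h))
    rw [Fin.sum_univ_castSucc, Fin.sum_univ_castSucc (f := ε)]
    have e1 : ∑ i : Fin l, 2 * (((l+1:ℕ):ℤ) - 1 - (((i.castSucc : Fin (l+1)):ℕ):ℤ)) * ε i.castSucc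
       = ∑ c : Fin l, 2 * ((l:ℤ) - 1 - ((c:ℕ):ℤ)) * ε c.castSucc
         + 2 * ∑ c : Fin l, ε c.castSucc := by
      rw [Finset.mul_sum, ← Finset.sum_add_distrib]
      refine Finset.sum_congr rfl (fun c _ => ?_)
      simp; ring
    rw [e1, ih]
    rcases h01 (Fin.last l) with h | h
    · have : ∀ c : Fin l, ε c.castSucc = 0 := by
        intro c
        have := hm c.castSucc (Fin.last l) (Fin.castSucc_lt_last c)
        rcases h01 c.castSucc with h' | h' <;> omega
      simp [this, h]
    · rw [h]; simp; ring

/-- flushness of the runners of the image of the empty multipartition, in summed form -/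
theorem flush (l : ℕ) (hl : 1 ≤ l) (K : ℤ) (m : Fin l → ℤ) (hK : ∀ c, -K ≤ m c)
    (hm : ∀ i j, i < j → 0 ≤ m j - m i ∧ m j - m i ≤ 1) :
    2 * ∑ c, ∑ q ∈ Finset.Ico (-K) (m c), ((l:ℤ) - 1 - ((c:ℕ):ℤ) + q * l)
      = (∑ c, m c) * (∑ c, m c - 1) - K * l * (K * l + 1) := by
  set c0 : Fin l := ⟨0, by omega⟩
  set a := m c0
  have hε : ∀ c, m c - a = 0 ∨ m c - a = 1 := by
    intro c
    by_cases h : c = c0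
    · left; rw [h]; simp [a]
    · have := hm c0 c (Fin.lt_def.2 (by
        have : (c:ℕ) ≠ 0 := fun h' => h (Fin.ext h')
        simp [c0]; omega))
      omega
  have h1 := mono01 l (fun c => m c - a) hε (fun i j h => by have := hm i j h; simp; omega)
  have h2 : ∀ c : Fin l, 2 * ∑ q ∈ Finset.Ico (-K) (m c), ((l:ℤ) - 1 - ((c:ℕ):ℤ) + q * l)
      = 2 * ((l:ℤ) - 1 - ((c:ℕ):ℤ)) * (m c - a) + 2 * (K + a) * ((l:ℤ) - 1 - ((c:ℕ):ℤ))
        + l * (2 * a * (m c - a) + a * a - a - K * (K + 1)) := by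
    intro c
    rw [Finset.sum_add_distrib, ← Finset.sum_mul, mul_add, ← mul_assoc, sum_Ico_id _ _ (hK c)]
    have : ((m c + K).toNat : ℤ) = m c + K := Int.toNat_of_nonneg (by have := hK c; omega)
    simp only [Finset.sum_const, Int.card_Ico, sub_neg_eq_add, nsmul_eq_mul, this]
    have hsq : (m c - a) * (m c - a) = m c - a := by
      rcases hε c with h | h <;> rw [h] <;> norm_num
    linear_combination (l:ℤ) * hsq
  have h3 : ∑ c : Fin l, 2 * ((l:ℤ) - 1 - ((c:ℕ):ℤ)) = l * (l - 1) := by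
    have := mono01 l (fun _ => 1) (by simp) (by simp)
    simp at this
    rw [this]; ring
  have h4 : ∑ c, m c = ∑ c, (m c - a) + l * a := by
    rw [Finset.sum_sub_distrib]; simp
  have h5 : ∑ c : Fin l, 2 * (K + a) * ((l:ℤ) - 1 - ((c:ℕ):ℤ)) = (K + a) * (l * (l - 1)) := by
    rw [← h3, Finset.mul_sum]
    exact Finset.sum_congr rfl (fun c _ => by ring)
  rw [Finset.mul_sum, Finset.sum_congr rfl (fun c _ => h2 c), Finset.sum_add_distrib,
    Finset.sum_add_distrib, h1, h5, ← Finset.mul_sum, h4]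
  have h6 : ∑ c : Fin l, (2 * a * (m c - a) + a * a - a - K * (K + 1))
      = 2 * a * ∑ c, (m c - a) + l * (a * a - a - K * (K + 1)) := by
    rw [Finset.mul_sum]
    simp only [Finset.sum_add_distrib, Finset.sum_sub_distrib]
    simp
    ring
  rw [h6]
  ring

/-- the Uglov embedding of component `c` -/
def uu (e l : ℕ) (c : Fin l) (x : ℤ) : ℤ :=
  ((l : ℤ) - 1 - ((c : ℕ) : ℤ)) * (e : ℤ) + (x / e) * (e : ℤ) * (l : ℤ) + x % e

theorem uglov_sum (e l : ℕ) (he : 0 < e) (K : ℤ) (s : Fin l → ℤ) (lam : Fin l → Ptn) (mu : Ptn)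
    (hmu : IsUglov e s lam mu) (hg : ∀ c, Good (K * e) (s c) (lam c))
    (hg' : Good (K * l * e) (∑ c, s c) mu) (f : ℤ → ℤ) :
    ∑ y ∈ BX (K * l * e) (∑ c, s c) mu, f y =
      ∑ c, ∑ x ∈ BX (K * e) (s c) (lam c), f (uu e l c x) := by
  have he' : (0:ℤ) < e := by exact_mod_cast he
  rw [Finset.sum_sigma' (s := Finset.univ) (t := fun c => BX (K * e) (s c) (lam c))
    (f := fun c x => f (uu e l c x))]
  symm
  have hpos : ∀ (c : Fin l) (q r : ℤ), 0 ≤ r → r < e →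
      (-(K * l * e) ≤ ((l : ℤ) - 1 - ((c : ℕ) : ℤ)) * (e : ℤ) + q * (e : ℤ) * (l : ℤ) + r ↔
        -(K * e) ≤ q * e + r) := by
    intro c q r h0 h1
    have hc : ((c:ℕ):ℤ) + 1 ≤ l := by exact_mod_cast c.2
    have hc0 : (0:ℤ) ≤ ((c:ℕ):ℤ) := by positivity
    have hb : 0 ≤ ((l : ℤ) - 1 - ((c : ℕ) : ℤ)) * (e : ℤ) := mul_nonneg (by linarith) he'.le
    have hb' : ((l : ℤ) - 1 - ((c : ℕ) : ℤ)) * (e : ℤ) ≤ (l - 1) * e :=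
      mul_le_mul_of_nonneg_right (by linarith) he'.le
    have hle : (0:ℤ) ≤ l * e := by positivity
    constructor
    · intro h
      have : -K ≤ q := by
        by_contra hq
        have hq : q + K + 1 ≤ 0 := by omega
        nlinarith [mul_nonneg hle (sub_nonneg.2 hq)]
      nlinarith
    · intro h
      have : -K ≤ q := by
        by_contra hq
        have hq : q + K + 1 ≤ 0 := by omega
        nlinarith
      nlinarith [mul_nonneg hle (by linarith : 0 ≤ q + K)]
  have hm0 : ∀ x : ℤ, 0 ≤ x % e := fun x => Int.emod_nonneg x he'.ne'
  have hm1 : ∀ x : ℤ, x % e < e := fun x => Int.emod_lt_of_pos x he'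
  have hdm : ∀ x : ℤ, x / e * e + x % e = x := fun x => Int.ediv_mul_add_emod x e
  refine Finset.sum_nbij (fun p => uu e l p.1 p.2) ?_ ?_ ?_ ?_
  · rintro ⟨c, x⟩ hx
    simp only [Finset.mem_sigma, Finset.mem_univ, true_and, mem_BX (hg c)] at hx
    rw [mem_BX hg', hmu]
    have hr : (((x % e).toNat : ℕ) : ℤ) = x % e := Int.toNat_of_nonneg (hm0 x)
    refine ⟨⟨c, x / e, (x % e).toNat, ?_, ?_, ?_⟩, ?_⟩
    · have := hm1 x; omega
    · rw [hr, hdm]; exact hx.1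
    · rw [hr]; rfl
    · rw [uu, hpos c _ _ (hm0 x) (hm1 x), hdm]; exact hx.2
  · rintro ⟨c, x⟩ _ ⟨c', x'⟩ _ h
    have h : uu e l c x = uu e l c' x' := h
    have hc : ((c:ℕ):ℤ) + 1 ≤ l := by exact_mod_cast c.2
    have hc0 : (0:ℤ) ≤ ((c:ℕ):ℤ) := by positivity
    have hc' : ((c':ℕ):ℤ) + 1 ≤ l := by exact_mod_cast c'.2
    have hc0' : (0:ℤ) ≤ ((c':ℕ):ℤ) := by positivity
    have a1 : ∀ (d : Fin l) (z : ℤ), uu e l d z =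
        z % e + e * (((l : ℤ) - 1 - ((d : ℕ) : ℤ)) + l * (z / e)) := by
      intro d z; unfold uu; ring
    have r1 : x % e = x' % e := by
      have := congrArg (· % (e:ℤ)) h
      simp only [a1, Int.add_mul_emod_self_left, Int.emod_emod] at this
      exact this
    have r2 : ((l : ℤ) - 1 - ((c : ℕ) : ℤ)) + l * (x / e) =
        ((l : ℤ) - 1 - ((c' : ℕ) : ℤ)) + l * (x' / e) := by
      rw [a1, a1, r1] at h
      exact mul_left_cancel₀ he'.ne' (by linarith)
    have r3 : ((c:ℕ):ℤ) = (c':ℕ) := by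
      have := congrArg (· % (l:ℤ)) r2
      simp only [Int.add_mul_emod_self_left] at this
      rw [Int.emod_eq_of_lt (by linarith) (by linarith),
        Int.emod_eq_of_lt (by linarith) (by linarith)] at this
      linarith
    have r4 : x / e = x' / e := by
      rw [r3] at r2
      have hl0 : (l:ℤ) ≠ 0 := by linarith
      exact mul_left_cancel₀ hl0 (by linarith)
    have r5 : x = x' := by rw [← hdm x, ← hdm x', r1, r4]
    have r6 : c = c' := Fin.ext (by exact_mod_cast r3)
    rw [r5, r6]
  · intro y hy
    rw [Finset.mem_coe, mem_BX hg', hmu] at hy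
    obtain ⟨⟨c, q, r, hr, hx, rfl⟩, hy⟩ := hy
    have hr' : (r:ℤ) < e := by exact_mod_cast hr
    have d1 : (q * (e:ℤ) + r) / e = q := by
      rw [Int.ediv_eq_iff_of_pos he']
      constructor <;> nlinarith
    have d2 : (q * (e:ℤ) + r) % e = r := by
      have := hdm (q * (e:ℤ) + r)
      rw [d1] at this; linarith
    refine ⟨⟨c, q * e + r⟩, ?_, ?_⟩
    · simp only [Finset.coe_sigma, Set.mem_sigma_iff, Finset.mem_coe, Finset.mem_univ, true_and,
        mem_BX (hg c)]
      exact ⟨hx, (hpos c q r (by positivity) hr').1 hy⟩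
    · simp only [uu, d1, d2]
  · rintro ⟨c, x⟩ _; rfl

theorem mm_abar (e : ℕ) (he : 0 < e) (a b i : ℤ) (h0 : 0 ≤ b - a) (h1 : b - a ≤ e) :
    0 ≤ mm e b i - mm e a i ∧ mm e b i - mm e a i ≤ 1 := by
  have A : ∀ q, q < mm e a i → q < mm e b i := by
    intro q; rw [lt_mm e he, lt_mm e he]; intro h; linarith
  have B : ∀ q, q < mm e b i → q - 1 < mm e a i := by
    intro q; rw [lt_mm e he, lt_mm e he]; intro h; linarith
  have := A (mm e a i - 1) (by omega)
  have := B (mm e b i - 1) (by omega)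
  omega

theorem exists_good {l : ℕ} (s : Fin l → ℤ) (lam : Fin l → Ptn) :
    ∃ B : ℤ, 0 ≤ B ∧ ∀ A, B ≤ A → ∀ c, Good A (s c) (lam c) := by
  choose N hN using fun c => (lam c).eventually_zero
  refine ⟨∑ c, ((N c : ℤ) + |s c|), Finset.sum_nonneg (fun c _ => by positivity), ?_⟩
  intro A hA c
  have h1 : (N c : ℤ) + |s c| ≤ A :=
    (Finset.single_le_sum (f := fun c => (N c : ℤ) + |s c|)
      (fun c _ => by positivity) (Finset.mem_univ c)).trans hA
  have h2 := neg_abs_le (s c)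
  refine ⟨by omega, fun n hn => hN c n (by omega)⟩

theorem g_uu (e l : ℕ) (he : 0 < e) (t : ℤ) (c : Fin l) (x : ℤ) :
    (uu e l c x - t) / (e:ℤ) = ((l : ℤ) - 1 - ((c : ℕ) : ℤ)) + (x / e) * l - mm e t (x % e) := by
  have he' : (e:ℤ) ≠ 0 := by positivity
  have : uu e l c x - t = (x % e - t) + e * (((l : ℤ) - 1 - ((c : ℕ) : ℤ)) + (x / e) * l) := by
    unfold uu; ring
  rw [this, Int.add_mul_ediv_left _ _ he', mm]
  ring

theorem g_s (e : ℕ) (he : 0 < e) (t x : ℤ) :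
    (x - t) / (e:ℤ) = x / e - mm e t (x % e) := by
  have he' : (e:ℤ) ≠ 0 := by positivity
  have : x - t = (x % e - t) + e * (x / e) := by
    have := Int.emod_add_mul_ediv x e
    linarith
  conv_lhs => rw [this]
  rw [Int.add_mul_ediv_left _ _ he', mm]
  ring

theorem cls_uu (e l : ℕ) (c : Fin l) (x i : ℤ) :
    (e:ℤ) ∣ uu e l c x - i ↔ (e:ℤ) ∣ x - i := by
  have : uu e l c x - i = (x - i) + e * (((l : ℤ) - 1 - ((c : ℕ) : ℤ)) + (x / e) * l - x / e) := by
    have := Int.emod_add_mul_ediv x e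
    unfold uu
    linear_combination this
  rw [this]
  exact dvd_add_left (Dvd.intro _ rfl)

/-- sum over `X` of `∑_j ⌊(x-s_j)/e⌋` against that of `⌊(u_c(x)-t)/e⌋` -/
theorem sum_G (e l : ℕ) (he : 0 < e) (s : Fin l → ℤ) (t : ℤ) (c : Fin l) (X : Finset ℤ) :
    ∑ x ∈ X, ∑ j, (x - s j) / (e:ℤ) = ∑ x ∈ X, (uu e l c x - t) / (e:ℤ)
      - ((l : ℤ) - 1 - ((c : ℕ) : ℤ)) * X.card
      - ∑ i ∈ Finset.range e, (∑ j, mm e (s j) i - mm e t i) * cls e X i := by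
  rw [← sum_mod e he X (fun i => ∑ j, mm e (s j) i - mm e t i)]
  have : ((l : ℤ) - 1 - ((c : ℕ) : ℤ)) * X.card = ∑ x ∈ X, ((l : ℤ) - 1 - ((c : ℕ) : ℤ)) := by
    simp; ring
  rw [this, ← Finset.sum_sub_distrib, ← Finset.sum_sub_distrib]
  refine Finset.sum_congr rfl (fun x _ => ?_)
  rw [g_uu e l he, Finset.sum_congr rfl (fun j _ => g_s e he (s j) x), Finset.sum_sub_distrib]
  simp
  ring

theorem core_sum (e l : ℕ) (he : 0 < e) (hl : 1 ≤ l) (s : Fin l → ℤ) (hs : Abar e s) (t K : ℤ)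
    (hK : ∀ c, 0 ≤ s c + K * e) :
    2 * ∑ c, ∑ x ∈ Finset.Ico (-(K * e)) (s c), (uu e l c x - t) / (e:ℤ) =
      ∑ i ∈ Finset.range e, ((∑ c, mm e (s c) i) * (∑ c, mm e (s c) i - 1) - K * l * (K * l + 1)
        - 2 * mm e t i * (∑ c, mm e (s c) i + K * l)) := by
  have he' : (0:ℤ) < e := by exact_mod_cast he
  rw [Finset.sum_congr rfl (fun c _ => sum_class e he (Finset.Ico (-(K * e)) (s c)) _),
    Finset.sum_comm, Finset.mul_sum]
  refine Finset.sum_congr rfl (fun i hi => ?_)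
  have hi := Finset.mem_range.1 hi
  have hi' : (i:ℤ) < e := by exact_mod_cast hi
  rw [← flush l hl K (fun c => mm e (s c) i) (fun c => neg_le_mm e he K (s c) (hK c) i hi)
    (fun a b hab => mm_abar e he _ _ _ (hs a b hab).1 (hs a b hab).2)]
  have hc : ∀ c : Fin l, ∑ x ∈ Finset.Ico (-(K * e)) (s c) with (e:ℤ) ∣ x - i,
        (uu e l c x - t) / (e:ℤ) =
      ∑ q ∈ Finset.Ico (-K) (mm e (s c) i), ((l:ℤ) - 1 - ((c:ℕ):ℤ) + q * l)
        - mm e t i * (mm e (s c) i + K) := by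
    intro c
    rw [sum_Ico_class e he K (s c) i hi]
    have h0 := neg_le_mm e he K (s c) (hK c) i hi
    have hcard : mm e t i * (mm e (s c) i + K) =
        ∑ q ∈ Finset.Ico (-K) (mm e (s c) i), mm e t i := by
      simp
      rw [max_eq_left (by omega)]; ring
    rw [hcard, ← Finset.sum_sub_distrib]
    refine Finset.sum_congr rfl (fun q _ => ?_)
    have d1 : ((i:ℤ) + q * e) / e = q := by
      rw [Int.ediv_eq_iff_of_pos he']
      constructor <;> nlinarith
    have d2 : ((i:ℤ) + q * e) % e = i := by
      have := Int.emod_add_mul_ediv ((i:ℤ) + q * e) e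
      rw [d1] at this; linarith
    rw [g_uu e l he, d1, d2]
  rw [Finset.sum_congr rfl (fun c _ => hc c), Finset.sum_sub_distrib, ← Finset.mul_sum,
    Finset.sum_add_distrib]
  simp
  ring

/-- the block weights agree under the Uglov map. -/
theorem stmt13 (e l : ℕ) (he : 2 ≤ e) (hl : 1 ≤ l) (s : Fin l → ℤ) (hs : Abar e s)
    (lam : Fin l → Ptn) (mu : Ptn) (hmu : IsUglov e s lam mu) :
    blockWeight e s lam = blockWeight₁ e (∑ k, s k) mu := by
  have he0 : 0 < e := by omega
  have he' : (0:ℤ) < e := by exact_mod_cast he0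
  obtain ⟨B1, hB1, hg1⟩ := exists_good s lam
  obtain ⟨B2, hB2, hg2⟩ := exists_good (fun _ : Fin 1 => ∑ k, s k) (fun _ => mu)
  set t := ∑ k, s k with ht
  obtain ⟨K, hKdef⟩ : ∃ K, K = B1 + B2 := ⟨_, rfl⟩
  have hl' : (1:ℤ) ≤ l := by exact_mod_cast hl
  have hK0 : 0 ≤ K := by omega
  have hKe : K ≤ K * e := by nlinarith
  have hKl : K ≤ K * l := by nlinarith
  have hKle : K * l ≤ K * l * e := by nlinarith
  have hg : ∀ c, Good (K * e) (s c) (lam c) := hg1 _ (by omega)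
  have hg' : ∀ c : Fin 1, Good (K * l * e) t mu := hg2 _ (by omega)
  have w1 := blockWeight_eq e he0 (K * e) s lam hg
  have w2 := blockWeight_eq e he0 (K * l * e) (fun _ : Fin 1 => t) (fun _ => mu) hg'
  have hu := uglov_sum e l he0 K s lam mu hmu hg (hg' 0)
  suffices h : 2 * blockWeight e s lam = 2 * blockWeight₁ e t mu by linarith
  rw [blockWeight₁, w1, w2]
  congr 1
  simp only [Fin.sum_univ_one, Finset.univ_unique, Finset.sum_singleton]
  -- class counts
  have hcls : ∀ i : ℤ, cls e (BX (K * l * e) t mu) i = ∑ c, cls e (BX (K * e) (s c) (lam c)) i := by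
    intro i
    unfold cls
    rw [hu]
    simp only [cls_uu]
  have hy : ∀ i ∈ Finset.range e, ∀ c, cls e (Finset.Ico (-(K * e)) (s c)) i = mm e (s c) i + K :=
    fun i hi c => cls_Ico e he0 K (s c) (hg c).1 i (Finset.mem_range.1 hi)
  have hy' : ∀ i ∈ Finset.range e, cls e (Finset.Ico (-(K * l * e)) t) i = mm e t i + K * l :=
    fun i hi => cls_Ico e he0 (K * l) t (hg' 0).1 i (Finset.mem_range.1 hi)
  -- sums of the first kind
  have hS : ∀ c, (∑ x ∈ BX (K * e) (s c) (lam c), ∑ j, (x - s j) / (e:ℤ) -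
      ∑ x ∈ Finset.Ico (-(K * e)) (s c), ∑ j, (x - s j) / (e:ℤ)) =
      ∑ x ∈ BX (K * e) (s c) (lam c), (uu e l c x - t) / (e:ℤ)
      - ∑ x ∈ Finset.Ico (-(K * e)) (s c), (uu e l c x - t) / (e:ℤ)
      - ∑ i ∈ Finset.range e, (∑ j, mm e (s j) i - mm e t i) *
        (cls e (BX (K * e) (s c) (lam c)) i - cls e (Finset.Ico (-(K * e)) (s c)) i) := by
    intro c
    rw [sum_G e l he0 s t c, sum_G e l he0 s t c (Finset.Ico _ _), card_BX, Int.card_Ico,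
      sub_neg_eq_add]
    simp only [mul_sub, Finset.sum_sub_distrib]
    ring
  rw [Finset.sum_congr rfl (fun c _ => hS c), Finset.sum_sub_distrib, Finset.sum_sub_distrib,
    ← hu (fun y => (y - t) / (e:ℤ)), Finset.sum_comm (s := Finset.univ)]
  have hz := core_sum e l he0 hl s hs t K (fun c => (hg c).1)
  have hz' := core_sum e 1 he0 le_rfl (fun _ => t) (fun a b hab => by omega) t (K * l)
    (fun _ => (hg' 0).1)
  have huu : ∀ x, uu e 1 0 x = x := by
    intro x
    have := Int.emod_add_mul_ediv x e
    unfold uu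
    simp
    linarith
  simp only [Fin.sum_univ_one, huu, Nat.cast_one, mul_one] at hz'
  have hM : ∑ i ∈ Finset.range e, (∑ c, mm e (s c) i - mm e t i) = 0 := by
    rw [Finset.sum_sub_distrib, Finset.sum_comm, sum_mm e he0,
      Finset.sum_congr rfl (fun c _ => sum_mm e he0 (s c)), ht, sub_self]
  have main : ∑ i ∈ Finset.range e,
      (((∑ c, mm e (s c) i) * (∑ c, mm e (s c) i - 1) - K * l * (K * l + 1)
        - 2 * mm e t i * (∑ c, mm e (s c) i + K * l))
       + 2 * (∑ c, (∑ j, mm e (s j) i - mm e t i) *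
        (cls e (BX (K * e) (s c) (lam c)) i - cls e (Finset.Ico (-(K * e)) (s c)) i))
       + (∑ c, (cls e (BX (K * e) (s c) (lam c)) i - cls e (Finset.Ico (-(K * e)) (s c)) i)) ^ 2
       + (∑ c, mm e (s c) i - mm e t i))
     = ∑ i ∈ Finset.range e,
      ((mm e t i * (mm e t i - 1) - K * l * (K * l + 1) - 2 * mm e t i * (mm e t i + K * l))
       + (cls e (BX (K * l * e) t mu) i - cls e (Finset.Ico (-(K * l * e)) t) i) ^ 2) := by
    refine Finset.sum_congr rfl (fun i hi => ?_)
    rw [hy' i hi, hcls, ← Finset.mul_sum, Finset.sum_sub_distrib,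
      Finset.sum_congr rfl (fun c _ => hy i hi c), Finset.sum_add_distrib]
    simp only [Finset.sum_const, Finset.card_univ, Fintype.card_fin, nsmul_eq_mul]
    ring
  simp only [Finset.sum_add_distrib] at main
  rw [hM, ← hz, ← Finset.mul_sum] at main
  rw [← hz'] at main
  linarith
end

section
/- Let e≥2 and s∈𝒜̄^l_e. An l-partition 𝛌 is a reduced (e,s)-core if and only if its block (e,s)-weight is zero: p_{(e,s)}(𝛌)=0. -/
namespace BW

/-- number of elements of `X` with residue `i` -/
def nn (e : ℕ) (X : Finset ℕ) (i : ZMod e) : ℕ := (X.filter (fun x : ℕ => (x : ZMod e) = i)).card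

def R (e : ℕ) (i : ZMod e) (y b : ℕ) : ℕ :=
  ((Finset.range b).filter (fun t => ((y + t + 1 : ℕ) : ZMod e) = i)).card

lemma R_succ (e : ℕ) (i : ZMod e) (y b : ℕ) :
    R e i y (b+1) = R e i y b + if ((y + b + 1 : ℕ) : ZMod e) = i then 1 else 0 := by
  unfold R
  rw [Finset.range_add_one, Finset.filter_insert]
  split_ifs with h
  · rw [Finset.card_insert_of_notMem (by simp)]
  · rfl

lemma R_diff (e : ℕ) (i : ZMod e) (y b : ℕ) :
    (R e i y b : ℤ) - R e (i+1) y b =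
      (if ((y + b : ℕ) : ZMod e) = i then 1 else 0) - (if ((y : ℕ) : ZMod e) = i then 1 else 0) := by
  induction b with
  | zero => simp [R]
  | succ b ih =>
    rw [R_succ, R_succ]
    have h : (((y + b + 1 : ℕ) : ZMod e) = i + 1) ↔ (((y + b : ℕ) : ZMod e) = i) := by
      rw [Nat.cast_succ]; exact add_left_inj 1
    simp only [h]
    rw [← Nat.add_assoc]
    push_cast at ih ⊢
    linarith

lemma R_zero (e : ℕ) (y b : ℕ) :
    (R e 0 y b : ℤ) = ((y + b) / e : ℕ) - (y / e : ℕ) := by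
  induction b with
  | zero => simp [R]
  | succ b ih =>
    rw [R_succ, ← Nat.add_assoc, Nat.succ_div]
    simp only [ZMod.natCast_eq_zero_iff]
    push_cast at ih ⊢
    linarith

def X (K : ℕ) (lam : Ptn) : Finset ℕ :=
  (Finset.range K).image (fun j => (K - 1 - j) + lam.parts j)

lemma X_inj (K : ℕ) (lam : Ptn) :
    Set.InjOn (fun j => (K - 1 - j) + lam.parts j) (Finset.range K : Finset ℕ) := by
  intro a ha b hb hab
  simp only [Finset.coe_range, Set.mem_Iio] at ha hb
  simp only at hab
  rcases lt_trichotomy a b with h | h | h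
  · have := lam.antitone' h.le; omega
  · exact h
  · have := lam.antitone' h.le; omega

lemma sum_X {M : Type*} [AddCommMonoid M] (K : ℕ) (lam : Ptn) (f : ℕ → M) :
    ∑ x ∈ X K lam, f x = ∑ j ∈ Finset.range K, f ((K - 1 - j) + lam.parts j) := by
  unfold X
  rw [Finset.sum_image (X_inj K lam)]

lemma card_X (K : ℕ) (lam : Ptn) : (X K lam).card = K := by
  unfold X
  rw [Finset.card_image_of_injOn (X_inj K lam), Finset.card_range]

lemma mem_abacus (K : ℕ) (lam : Ptn) (s m : ℤ) (hs : s = K - m)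
    (h : ∀ j, K ≤ j → lam.parts j = 0) (x : ℤ) :
    x ∈ abacus s lam ↔ x + m < 0 ∨ ∃ n ∈ X K lam, x + m = n := by
  subst hs
  simp only [abacus, Set.mem_setOf_eq, X, Finset.mem_image, Finset.mem_range]
  constructor
  · rintro ⟨j, hj⟩
    by_cases hK : j < K
    · right
      refine ⟨_, ⟨j, hK, rfl⟩, ?_⟩
      omega
    · left
      have := h j (by omega)
      omega
  · rintro (h1 | ⟨n, ⟨j, hj, rfl⟩, hn⟩)
    · refine ⟨(K - 1 - (x + m)).toNat, ?_⟩
      have := h (K - 1 - (x + m)).toNat (by omega)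
      omega
    · exact ⟨j, by omega⟩

lemma resCount_eq (e : ℕ) {l : ℕ} (K : Fin l → ℕ) (M : ℤ) (s : Fin l → ℤ) (lam : Fin l → Ptn)
    (hs : ∀ c, s c = K c - M * e) (h : ∀ c j, K c ≤ j → (lam c).parts j = 0) (i : ZMod e) :
    resCount e s lam i = ∑ c, ∑ j ∈ Finset.range (K c), R e i (K c - 1 - j) ((lam c).parts j) := by
  classical
  let S : Finset (Σ _ : Fin l, Σ _ : ℕ, ℕ) :=
    Finset.univ.sigma fun c => (Finset.range (K c)).sigma fun j =>
      (Finset.range ((lam c).parts j)).filter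
        (fun t => (((K c - 1 - j) + t + 1 : ℕ) : ZMod e) = i)
  have hS : S.card = ∑ c, ∑ j ∈ Finset.range (K c), R e i (K c - 1 - j) ((lam c).parts j) := by
    simp only [S, Finset.card_sigma, R]
  rw [← hS, ← Set.ncard_coe_finset]
  have hinj : Function.Injective
      (fun p : (Σ _ : Fin l, Σ _ : ℕ, ℕ) => ((p.2.1, p.2.2, p.1) : ℕ × ℕ × Fin l)) := by
    rintro ⟨a, b, c⟩ ⟨a', b', c'⟩ h
    simp only [Prod.mk.injEq] at h
    obtain ⟨rfl, rfl, rfl⟩ := h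
    rfl
  rw [← Set.ncard_image_of_injective _ hinj]
  unfold resCount
  congr 1
  have key : ∀ (a b : ℕ) (c : Fin l), a < K c →
      res e s (a, b, c) = (((K c - 1 - a) + b + 1 : ℕ) : ZMod e) := by
    intro a b c ha
    unfold res
    have : ((b : ℤ) - a + s c) = (((K c - 1 - a) + b + 1 : ℕ) : ℤ) - M * e := by
      rw [hs]; omega
    simp only [this]
    push_cast
    simp
  ext ⟨a, b, c⟩
  simp only [Set.mem_setOf_eq, diag, Set.mem_image, Finset.mem_coe, S, Finset.mem_sigma,
    Finset.mem_univ, true_and, Finset.mem_range, Finset.mem_filter, Sigma.exists]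
  constructor
  · rintro ⟨h1, h2⟩
    have ha : a < K c := by
      by_contra hc
      have := h c a (by omega)
      omega
    rw [key a b c ha] at h2
    exact ⟨c, a, b, ⟨ha, h1, h2⟩, rfl⟩
  · rintro ⟨c', a', b', ⟨ha, h1, h2⟩, heq⟩
    simp only [Prod.mk.injEq] at heq
    obtain ⟨rfl, rfl, rfl⟩ := heq
    exact ⟨h1, by rw [key _ _ _ ha]; exact h2⟩

lemma nn_eq_sum (e : ℕ) (Y : Finset ℕ) (i : ZMod e) :
    (nn e Y i : ℤ) = ∑ x ∈ Y, if (x : ZMod e) = i then 1 else 0 := by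
  unfold nn
  rw [Finset.card_filter]; push_cast; rfl

lemma resCount_diff (e : ℕ) {l : ℕ} (K : Fin l → ℕ) (M : ℤ) (s : Fin l → ℤ) (lam : Fin l → Ptn)
    (hs : ∀ c, s c = K c - M * e) (h : ∀ c j, K c ≤ j → (lam c).parts j = 0) (i : ZMod e) :
    (resCount e s lam i : ℤ) - resCount e s lam (i+1) =
      ∑ c, (nn e (X (K c) (lam c)) i : ℤ) - ∑ c, (nn e (Finset.range (K c)) i : ℤ) := by
  rw [resCount_eq e K M s lam hs h, resCount_eq e K M s lam hs h]
  push_cast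
  rw [← Finset.sum_sub_distrib, ← Finset.sum_sub_distrib]
  refine Finset.sum_congr rfl fun c _ => ?_
  rw [← Finset.sum_sub_distrib, nn_eq_sum, nn_eq_sum, sum_X,
    ← Finset.sum_range_reflect (fun x : ℕ => (if (x : ZMod e) = i then (1 : ℤ) else 0)) (K c),
    ← Finset.sum_sub_distrib]
  refine Finset.sum_congr rfl fun j hj => ?_
  rw [R_diff]

lemma resCount_zero (e : ℕ) {l : ℕ} (K : Fin l → ℕ) (M : ℤ) (s : Fin l → ℤ) (lam : Fin l → Ptn)
    (hs : ∀ c, s c = K c - M * e) (h : ∀ c j, K c ≤ j → (lam c).parts j = 0) :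
    (resCount e s lam 0 : ℤ) =
      ∑ c, ∑ x ∈ X (K c) (lam c), ((x / e : ℕ) : ℤ) -
        ∑ c, ∑ x ∈ Finset.range (K c), ((x / e : ℕ) : ℤ) := by
  rw [resCount_eq e K M s lam hs h]
  push_cast
  rw [← Finset.sum_sub_distrib]
  refine Finset.sum_congr rfl fun c _ => ?_
  rw [sum_X, ← Finset.sum_range_reflect (fun x => ((x : ℤ) / (e : ℤ))) (K c),
    ← Finset.sum_sub_distrib]
  refine Finset.sum_congr rfl fun j hj => ?_
  rw [R_zero]
  push_cast
  rfl

lemma flush0 (Y : Finset ℕ) :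
    (Y.card : ℤ) * (Y.card - 1) ≤ ∑ y ∈ Y, 2 * (y : ℤ) ∧
    ((Y.card : ℤ) * (Y.card - 1) = ∑ y ∈ Y, 2 * (y : ℤ) ↔ ∀ q, q + 1 ∈ Y → q ∈ Y) ∧
    ((∀ q, q + 1 ∈ Y → q ∈ Y) → Y = Finset.range Y.card) := by
  have hr : ∀ n : ℕ, ∑ y ∈ Finset.range n, 2 * (y : ℤ) = (n : ℤ) * (n - 1) := by
    intro n
    induction n with
    | zero => simp
    | succ n ih => rw [Finset.sum_range_succ, ih]; push_cast; ring
  have hdown : (∀ q, q + 1 ∈ Y → q ∈ Y) → Y = Finset.range Y.card := by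
    intro hq
    have hlow : ∀ k q, q + k ∈ Y → q ∈ Y := by
      intro k
      induction k with
      | zero => intro q h; exact h
      | succ k ih => intro q h; exact ih q (hq _ h)
    apply Finset.eq_of_subset_of_card_le
    · intro y hy
      rw [Finset.mem_range]
      have : Finset.range (y+1) ⊆ Y := by
        intro z hz
        rw [Finset.mem_range] at hz
        apply hlow (y - z) z
        rwa [Nat.add_sub_cancel' (by omega)]
      have := Finset.card_le_card this
      rw [Finset.card_range] at this
      omega
    · simp
  have hsum : ∑ y ∈ Y, 2 * ((y : ℤ) - Y.card) - ∑ y ∈ Finset.range Y.card, 2 * ((y : ℤ) - Y.card)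
      = ∑ y ∈ Y, 2 * (y : ℤ) - (Y.card : ℤ) * (Y.card - 1) := by
    simp only [mul_sub, Finset.sum_sub_distrib, Finset.sum_const, hr, Finset.card_range]
    ring
  have hsplit := Finset.sum_sdiff_sub_sum_sdiff (s₁ := Finset.range Y.card) (s₂ := Y)
    (f := fun y : ℕ => 2 * ((y : ℤ) - Y.card))
  have h1 : 0 ≤ ∑ y ∈ Y \ Finset.range Y.card, 2 * ((y : ℤ) - Y.card) := by
    apply Finset.sum_nonneg
    intro y hy
    simp at hy
    omega
  have h2 : ∑ y ∈ Finset.range Y.card \ Y, 2 * ((y : ℤ) - Y.card) ≤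
      -((Finset.range Y.card \ Y).card : ℤ) := by
    rw [← mul_neg_one, ← nsmul_eq_mul]
    apply Finset.sum_le_card_nsmul
    intro y hy
    simp at hy
    omega
  refine ⟨by linarith, ⟨fun heq => ?_, fun hq => ?_⟩, hdown⟩
  · have h3 : (Finset.range Y.card \ Y).card = 0 := by
      have : (0:ℤ) ≤ ((Finset.range Y.card \ Y).card : ℤ) := by positivity
      have : ((Finset.range Y.card \ Y).card : ℤ) = 0 := by linarith
      exact_mod_cast this
    rw [Finset.card_eq_zero, Finset.sdiff_eq_empty_iff_subset] at h3
    have h4 := Finset.eq_of_subset_of_card_le h3 (by simp)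
    intro q hq
    rw [← h4] at hq ⊢
    simp at hq ⊢
    omega
  · rw [← hr]
    rw [← hdown hq]

def Dn (e : ℕ) (Y : Finset ℕ) : Prop := ∀ x ∈ Y, e ≤ x → x - e ∈ Y

def runner (e : ℕ) (Y : Finset ℕ) (i : ZMod e) : Finset ℕ :=
  (Y.filter (fun x : ℕ => (x : ZMod e) = i)).image (· / e)

lemma cast_eq_iff (e : ℕ) [NeZero e] (x : ℕ) (i : ZMod e) : (x : ZMod e) = i ↔ x % e = i.val := by
  rw [← ZMod.val_natCast]
  exact (ZMod.val_injective e).eq_iff.symm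

lemma runner_inj (e : ℕ) [NeZero e] (Y : Finset ℕ) (i : ZMod e) :
    Set.InjOn (· / e) ((Y.filter (fun x : ℕ => (x : ZMod e) = i) : Finset ℕ) : Set ℕ) := by
  intro a ha b hb hab
  simp only [Finset.coe_filter, Set.mem_setOf_eq, cast_eq_iff] at ha hb
  simp only at hab
  rw [← Nat.div_add_mod a e, ← Nat.div_add_mod b e, hab, ha.2, hb.2]

lemma mem_runner (e : ℕ) [NeZero e] (Y : Finset ℕ) (i : ZMod e) (q : ℕ) :
    q ∈ runner e Y i ↔ e * q + i.val ∈ Y := by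
  have hi := ZMod.val_lt i
  have he : 0 < e := Nat.pos_of_ne_zero (NeZero.ne e)
  simp only [runner, Finset.mem_image, Finset.mem_filter, cast_eq_iff]
  constructor
  · rintro ⟨x, ⟨h1, h2⟩, rfl⟩
    rw [← h2, Nat.div_add_mod]; exact h1
  · intro h
    refine ⟨_, ⟨h, ?_⟩, ?_⟩
    · rw [Nat.mul_add_mod, Nat.mod_eq_of_lt hi]
    · rw [Nat.mul_add_div he, Nat.div_eq_of_lt hi, add_zero]

lemma card_runner (e : ℕ) [NeZero e] (Y : Finset ℕ) (i : ZMod e) :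
    (runner e Y i).card = nn e Y i := Finset.card_image_of_injOn (runner_inj e Y i)

lemma Dn_iff (e : ℕ) [NeZero e] (Y : Finset ℕ) :
    Dn e Y ↔ ∀ i : ZMod e, ∀ q, q + 1 ∈ runner e Y i → q ∈ runner e Y i := by
  simp only [mem_runner]
  constructor
  · intro h i q hq
    have := h _ hq (by rw [mul_add]; omega)
    convert this using 1
    rw [mul_add]; omega
  · intro h x hx hex
    have he : 0 < e := Nat.pos_of_ne_zero (NeZero.ne e)
    have := h (x : ZMod e) ((x - e) / e)
    rw [ZMod.val_natCast] at this
    have h1 : (x - e) / e + 1 = x / e := by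
      rw [Nat.div_eq_sub_div he hex]
    rw [h1, Nat.div_add_mod] at this
    have h2 := this hx
    have h3 : x % e = (x - e) % e := Nat.mod_eq_sub_mod hex
    rw [h3, Nat.div_add_mod] at h2
    exact h2

lemma Dn_mem (e : ℕ) [NeZero e] (Y : Finset ℕ) (h : Dn e Y) (x : ℕ) :
    x ∈ Y ↔ x / e < nn e Y (x : ZMod e) := by
  have h1 := (flush0 (runner e Y (x : ZMod e))).2.2 ((Dn_iff e Y).1 h _)
  rw [card_runner] at h1
  rw [← Finset.mem_range, ← h1, mem_runner, ZMod.val_natCast, Nat.div_add_mod]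

/-- excess -/
def Ex (e : ℕ) [NeZero e] (Y : Finset ℕ) : ℤ :=
  ∑ x ∈ Y, 2 * ((x / e : ℕ) : ℤ) - ∑ i : ZMod e, (nn e Y i : ℤ) * (nn e Y i - 1)

lemma Ex_eq (e : ℕ) [NeZero e] (Y : Finset ℕ) :
    Ex e Y = ∑ i : ZMod e, (∑ q ∈ runner e Y i, 2 * (q : ℤ) -
      ((runner e Y i).card : ℤ) * ((runner e Y i).card - 1)) := by
  unfold Ex
  rw [Finset.sum_sub_distrib]
  simp only [card_runner]
  congr 1
  rw [← Finset.sum_fiberwise Y (fun x => (x : ZMod e))]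
  refine Finset.sum_congr rfl fun i _ => ?_
  unfold runner
  rw [Finset.sum_image (runner_inj e Y i)]

lemma Ex_nonneg (e : ℕ) [NeZero e] (Y : Finset ℕ) : 0 ≤ Ex e Y := by
  rw [Ex_eq]
  exact Finset.sum_nonneg fun i _ => sub_nonneg.2 (flush0 _).1

lemma Ex_zero (e : ℕ) [NeZero e] (Y : Finset ℕ) : Ex e Y = 0 ↔ Dn e Y := by
  rw [Ex_eq, Finset.sum_eq_zero_iff_of_nonneg (fun i _ => sub_nonneg.2 (flush0 _).1), Dn_iff]
  refine forall_congr' fun i => ?_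
  rw [← (flush0 _).2.1, sub_eq_zero, eq_comm]
  simp

lemma sum_nn (e : ℕ) [NeZero e] (Y : Finset ℕ) : ∑ i : ZMod e, (nn e Y i : ℤ) = Y.card := by
  have := Finset.card_eq_sum_card_fiberwise (s := Y) (t := (Finset.univ : Finset (ZMod e)))
    (f := fun x : ℕ => (x : ZMod e)) (by intro x _; simp)
  rw [this]; push_cast; rfl

/-- pair discrepancy -/
def Pr (e : ℕ) [NeZero e] (Y Z : Finset ℕ) : ℤ :=
  ∑ i : ZMod e, ((nn e Y i : ℤ) - nn e Z i)^2 - |(Y.card : ℤ) - Z.card|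

lemma Pr_symm (e : ℕ) [NeZero e] (Y Z : Finset ℕ) : Pr e Y Z = Pr e Z Y := by
  unfold Pr
  rw [abs_sub_comm]
  congr 1
  refine Finset.sum_congr rfl fun i _ => by ring

lemma Pr_eq (e : ℕ) [NeZero e] (Y Z : Finset ℕ) (h : Z.card ≤ Y.card) :
    Pr e Y Z = ∑ i : ZMod e, (((nn e Y i : ℤ) - nn e Z i)^2 - ((nn e Y i : ℤ) - nn e Z i)) := by
  unfold Pr
  rw [abs_of_nonneg (by omega), Finset.sum_sub_distrib, Finset.sum_sub_distrib, sum_nn, sum_nn]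

lemma sq_sub_nonneg (x : ℤ) : 0 ≤ x^2 - x := by
  rcases le_or_gt x 0 with h | h <;> nlinarith

lemma Pr_nonneg (e : ℕ) [NeZero e] (Y Z : Finset ℕ) : 0 ≤ Pr e Y Z := by
  rcases le_total Z.card Y.card with h | h
  · rw [Pr_eq e Y Z h]
    exact Finset.sum_nonneg fun i _ => sq_sub_nonneg _
  · rw [Pr_symm, Pr_eq e Z Y h]
    exact Finset.sum_nonneg fun i _ => sq_sub_nonneg _

lemma Pr_zero (e : ℕ) [NeZero e] (Y Z : Finset ℕ) (h : Z.card ≤ Y.card) :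
    Pr e Y Z = 0 ↔ ∀ i, nn e Z i ≤ nn e Y i ∧ nn e Y i ≤ nn e Z i + 1 := by
  rw [Pr_eq e Y Z h, Finset.sum_eq_zero_iff_of_nonneg (fun i _ => sq_sub_nonneg _)]
  refine forall_congr' fun i => ?_
  simp only [Finset.mem_univ, true_imp_iff]
  constructor
  · intro h
    have h1 : ((nn e Y i : ℤ) - nn e Z i) * ((nn e Y i : ℤ) - nn e Z i - 1) = 0 := by
      rw [← h]; ring
    rcases mul_eq_zero.1 h1 with h | h <;> omega
  · rintro ⟨h1, h2⟩
    have : (nn e Y i : ℤ) - nn e Z i = 0 ∨ (nn e Y i : ℤ) - nn e Z i = 1 := by omega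
    rcases this with h | h <;> rw [h] <;> norm_num

lemma energy (e : ℕ) [NeZero e] {l : ℕ} (Y : Fin l → Finset ℕ) :
    4 * (l : ℤ) * ∑ c, ∑ x ∈ Y c, ((x / e : ℕ) : ℤ) - 2 * ∑ i : ZMod e, (∑ c, (nn e (Y c) i : ℤ))^2
      = 2 * (l : ℤ) * ∑ c, Ex e (Y c) + ∑ c, ∑ d, Pr e (Y c) (Y d)
        + ∑ c, ∑ d, |((Y c).card : ℤ) - (Y d).card| - 2 * (l : ℤ) * ∑ c, ((Y c).card : ℤ) := by
  have h1 : ∑ c, ∑ d, Pr e (Y c) (Y d) + ∑ c, ∑ d, |((Y c).card : ℤ) - (Y d).card|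
      = 2 * (l : ℤ) * ∑ c, ∑ i : ZMod e, (nn e (Y c) i : ℤ)^2
        - 2 * ∑ i : ZMod e, (∑ c, (nn e (Y c) i : ℤ))^2 := by
    simp only [Pr, Finset.sum_sub_distrib, sub_add_cancel]
    have : ∀ c d, ∑ i : ZMod e, ((nn e (Y c) i : ℤ) - nn e (Y d) i)^2 =
        ∑ i : ZMod e, (nn e (Y c) i : ℤ)^2 + ∑ i : ZMod e, (nn e (Y d) i : ℤ)^2
          - 2 * ∑ i : ZMod e, (nn e (Y c) i : ℤ) * nn e (Y d) i := by
      intro c d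
      rw [Finset.mul_sum, ← Finset.sum_add_distrib, ← Finset.sum_sub_distrib]
      exact Finset.sum_congr rfl fun i _ => by ring
    simp only [this, Finset.sum_sub_distrib, Finset.sum_add_distrib, Finset.sum_const,
      Finset.card_univ, Fintype.card_fin, nsmul_eq_mul, ← Finset.mul_sum]
    have h3 : ∑ c, ∑ d, ∑ i : ZMod e, (nn e (Y c) i : ℤ) * nn e (Y d) i
        = ∑ i : ZMod e, (∑ c, (nn e (Y c) i : ℤ))^2 := by
      simp only [sq, Finset.sum_mul_sum]
      simp_rw [Finset.sum_comm (s := (Finset.univ : Finset (ZMod e)))]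
    rw [h3]
    ring
  have h2 : ∑ c, Ex e (Y c) = 2 * ∑ c, ∑ x ∈ Y c, ((x / e : ℕ) : ℤ)
      - ∑ c, ∑ i : ZMod e, (nn e (Y c) i : ℤ)^2 + ∑ c, ((Y c).card : ℤ) := by
    rw [Finset.mul_sum, ← Finset.sum_sub_distrib, ← Finset.sum_add_distrib]
    refine Finset.sum_congr rfl fun c _ => ?_
    unfold Ex
    rw [← sum_nn e, ← Finset.mul_sum]
    have : ∑ i : ZMod e, (nn e (Y c) i : ℤ) * (nn e (Y c) i - 1)
      = ∑ i : ZMod e, (nn e (Y c) i : ℤ)^2 - ∑ i : ZMod e, (nn e (Y c) i : ℤ) := by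
      rw [← Finset.sum_sub_distrib]
      exact Finset.sum_congr rfl fun i _ => by ring
    rw [this]; ring
  rw [h2]
  linear_combination (-1) * h1

lemma sum_range_zmod {A : Type*} [AddCommMonoid A] (e : ℕ) [NeZero e] (f : ZMod e → A) :
    ∑ i ∈ Finset.range e, f (i : ZMod e) = ∑ i : ZMod e, f i := by
  refine Finset.sum_bij' (fun i _ => (i : ZMod e)) (fun i _ => i.val) ?_ ?_ ?_ ?_ ?_
  · simp
  · intro i _; simpa using ZMod.val_lt i
  · intro i hi; rw [ZMod.val_natCast]; exact Nat.mod_eq_of_lt (by simpa using hi)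
  · intro i _; simp
  · intro i _; rfl

lemma vac_Dn (e k : ℕ) : Dn e (Finset.range k) := by
  intro x hx _
  simp at hx ⊢
  omega

lemma vac_Pr (e : ℕ) [NeZero e] (a b : ℕ) (h1 : a ≤ b) (h2 : b ≤ a + e) :
    Pr e (Finset.range b) (Finset.range a) = 0 := by
  rw [Pr_zero _ _ _ (by simpa using h1)]
  intro i
  constructor
  · exact Finset.card_le_card (Finset.filter_subset_filter _ (by simpa using h1))
  · have : nn e (Finset.range b) i ≤ nn e (Finset.range a) i + nn e (Finset.Ico a b) i := by
      unfold nn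
      refine le_trans (Finset.card_le_card ?_) (Finset.card_union_le _ _)
      intro x
      simp only [Finset.mem_filter, Finset.mem_union, Finset.mem_range, Finset.mem_Ico]
      rintro ⟨hx, hi⟩
      by_cases hxa : x < a
      · exact Or.inl ⟨hxa, hi⟩
      · exact Or.inr ⟨⟨by omega, hx⟩, hi⟩
    have h3 : nn e (Finset.Ico a b) i ≤ 1 := by
      unfold nn
      rw [Finset.card_le_one]
      intro x hx y hy
      simp only [Finset.mem_filter, Finset.mem_Ico] at hx hy
      have h4 : (x : ZMod e) = y := hx.2.trans hy.2.symm
      rw [ZMod.natCast_eq_natCast_iff] at h4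
      rcases le_total x y with h | h
      · have := (Nat.modEq_iff_dvd' h).1 h4
        have := Nat.eq_zero_of_dvd_of_lt this (by omega)
        omega
      · have := (Nat.modEq_iff_dvd' h).1 h4.symm
        have := Nat.eq_zero_of_dvd_of_lt this (by omega)
        omega
    omega

lemma weight_eq (e : ℕ) [NeZero e] {l : ℕ} (K : Fin l → ℕ) (M : ℤ) (s : Fin l → ℤ)
    (lam : Fin l → Ptn) (hA : Abar e s)
    (hs : ∀ c, s c = K c - M * e) (h : ∀ c j, K c ≤ j → (lam c).parts j = 0) :
    4 * blockWeight e s lam = ((2 * (l : ℤ) * ∑ c, Ex e (X (K c) (lam c)) +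
      ∑ c, ∑ d, Pr e (X (K c) (lam c)) (X (K d) (lam d)) : ℤ) : ℚ) := by
  have E1 := energy e (fun c => X (K c) (lam c))
  have E0 := energy e (fun c => Finset.range (K c))
  simp only [card_X, Finset.card_range] at E1 E0
  have z1 : ∑ c, Ex e (Finset.range (K c)) = 0 :=
    Finset.sum_eq_zero fun c _ => (Ex_zero _ _).2 (vac_Dn _ _)
  have z2 : ∑ c, ∑ d, Pr e (Finset.range (K c)) (Finset.range (K d)) = 0 := by
    refine Finset.sum_eq_zero fun c _ => Finset.sum_eq_zero fun d _ => ?_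
    rcases lt_trichotomy c d with hcd | hcd | hcd
    · have := hA c d hcd
      rw [hs, hs] at this
      rw [Pr_symm]
      exact vac_Pr _ _ _ (by omega) (by omega)
    · subst hcd; exact vac_Pr _ _ _ (by omega) (by omega)
    · have := hA d c hcd
      rw [hs, hs] at this
      exact vac_Pr _ _ _ (by omega) (by omega)
  rw [z1, z2] at E0
  have hc0 := resCount_zero e K M s lam hs h
  have hd := resCount_diff e K M s lam hs h
  set C : ZMod e → ℤ := fun i => (resCount e s lam i : ℤ) with hC
  set N : ZMod e → ℤ := fun i => ∑ c, (nn e (X (K c) (lam c)) i : ℤ) with hN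
  set N0 : ZMod e → ℤ := fun i => ∑ c, (nn e (Finset.range (K c)) i : ℤ) with hN0
  have hd' : ∀ i, C i - C (i+1) = N i - N0 i := hd
  have tel : ∀ k : ℕ, C (k : ZMod e) = C 0 - ∑ y ∈ Finset.range k, (N (y : ZMod e) - N0 (y : ZMod e)) := by
    intro k
    induction k with
    | zero => simp
    | succ k ih =>
      rw [Finset.sum_range_succ, ← hd', Nat.cast_succ]
      linarith
  have fib : ∀ k : ℕ, ∑ y ∈ Finset.range k, (N (y : ZMod e) - N0 (y : ZMod e))
      = ∑ i : ZMod e, (nn e (Finset.range k) i : ℤ) * (N i - N0 i) := by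
    intro k
    rw [← Finset.sum_fiberwise (Finset.range k) (fun x => (x : ZMod e))]
    refine Finset.sum_congr rfl fun i _ => ?_
    rw [Finset.sum_congr rfl (g := fun _ => N i - N0 i)]
    · rw [Finset.sum_const, nsmul_eq_mul]; rfl
    · intro x hx
      rw [(Finset.mem_filter.1 hx).2]
  have first : ∑ c, C ((s c : ℤ) : ZMod e) = l * C 0 - ∑ i : ZMod e, N0 i * (N i - N0 i) := by
    have : ∀ c, C ((s c : ℤ) : ZMod e) =
        C 0 - ∑ i : ZMod e, (nn e (Finset.range (K c)) i : ℤ) * (N i - N0 i) := by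
      intro c
      rw [← fib, ← tel, hs]
      push_cast
      simp
    simp only [this, Finset.sum_sub_distrib, Finset.sum_const, Finset.card_univ, Fintype.card_fin,
      nsmul_eq_mul]
    rw [Finset.sum_comm]
    congr 1
    refine Finset.sum_congr rfl fun i _ => ?_
    rw [hN0, Finset.sum_mul]
  have second : ∑ i : ZMod e, (C i - C (i - 1))^2 = ∑ i : ZMod e, (N i - N0 i)^2 := by
    rw [← Equiv.sum_comp (Equiv.addRight (1 : ZMod e))]
    refine Finset.sum_congr rfl fun i _ => ?_
    rw [← hd']
    simp only [Equiv.coe_addRight, add_sub_cancel_right]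
    ring
  have hw : 4 * blockWeight e s lam =
      ((4 * ∑ c, C ((s c : ℤ) : ZMod e) - 2 * ∑ i : ZMod e, (C i - C (i - 1))^2 : ℤ) : ℚ) := by
    unfold blockWeight
    rw [sum_range_zmod e (fun i => ((resCount e s lam i : ℚ) - (resCount e s lam (i - 1) : ℚ)) ^ 2)]
    simp only [hC]
    push_cast
    ring
  rw [hw]
  congr 1
  rw [first, second]
  have hc0' : C 0 = _ := hc0
  rw [hc0']
  have alg : ∑ i : ZMod e, (N i - N0 i)^2 =
      ∑ i : ZMod e, (N i)^2 - ∑ i : ZMod e, (N0 i)^2 - 2 * ∑ i : ZMod e, N0 i * (N i - N0 i) := by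
    rw [Finset.mul_sum, ← Finset.sum_sub_distrib, ← Finset.sum_sub_distrib]
    exact Finset.sum_congr rfl fun i _ => by ring
  rw [alg]
  linear_combination E1 - E0

lemma weight_zero (e : ℕ) [NeZero e] {l : ℕ} (hl : 1 ≤ l) (K : Fin l → ℕ) (M : ℤ) (s : Fin l → ℤ)
    (lam : Fin l → Ptn) (hA : Abar e s)
    (hs : ∀ c, s c = K c - M * e) (h : ∀ c j, K c ≤ j → (lam c).parts j = 0) :
    blockWeight e s lam = 0 ↔ (∀ c, Dn e (X (K c) (lam c))) ∧
      ∀ c d, c ≤ d → ∀ i, nn e (X (K c) (lam c)) i ≤ nn e (X (K d) (lam d)) i ∧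
        nn e (X (K d) (lam d)) i ≤ nn e (X (K c) (lam c)) i + 1 := by
  have hw := weight_eq e K M s lam hA hs h
  have hK : ∀ c d, c ≤ d → K c ≤ K d := by
    intro c d hcd
    rcases hcd.lt_or_eq with h | h
    · have := hA c d h
      rw [hs, hs] at this
      omega
    · rw [h]
  have e1 : blockWeight e s lam = 0 ↔ 4 * blockWeight e s lam = 0 := by
    constructor <;> intro h <;> linarith
  rw [e1, hw, Int.cast_eq_zero]
  have n1 : 0 ≤ ∑ c, Ex e (X (K c) (lam c)) := Finset.sum_nonneg fun _ _ => Ex_nonneg _ _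
  have n3 : ∀ c, 0 ≤ ∑ d, Pr e (X (K c) (lam c)) (X (K d) (lam d)) :=
    fun c => Finset.sum_nonneg fun _ _ => Pr_nonneg _ _ _
  have n2 : 0 ≤ ∑ c, ∑ d, Pr e (X (K c) (lam c)) (X (K d) (lam d)) :=
    Finset.sum_nonneg fun c _ => n3 c
  have hl' : (0 : ℤ) < 2 * l := by omega
  rw [add_eq_zero_iff_of_nonneg (mul_nonneg hl'.le n1) n2, mul_eq_zero_iff_left hl'.ne',
    Finset.sum_eq_zero_iff_of_nonneg (fun _ _ => Ex_nonneg _ _),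
    Finset.sum_eq_zero_iff_of_nonneg (fun c _ => n3 c)]
  simp only [Finset.mem_univ, true_imp_iff, Ex_zero]
  refine and_congr Iff.rfl ?_
  constructor
  · intro hh c d hcd
    have := (Finset.sum_eq_zero_iff_of_nonneg (fun _ _ => Pr_nonneg _ _ _)).1 (hh d) c
      (Finset.mem_univ _)
    rw [Pr_zero _ _ _ (by simpa [card_X] using hK c d hcd)] at this
    exact this
  · intro hh c
    refine Finset.sum_eq_zero fun d _ => ?_
    rcases le_total c d with hcd | hcd
    · rw [Pr_symm, Pr_zero _ _ _ (by simpa [card_X] using hK c d hcd)]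
      exact hh c d hcd
    · rw [Pr_zero _ _ _ (by simpa [card_X] using hK d c hcd)]
      exact hh d c hcd

lemma complete_iff (e : ℕ) [NeZero e] {l : ℕ} (hl : 1 ≤ l) (K : Fin l → ℕ) (M : ℤ) (s : Fin l → ℤ)
    (lam : Fin l → Ptn)
    (hs : ∀ c, s c = K c - M * e) (h : ∀ c j, K c ≤ j → (lam c).parts j = 0) :
    Complete e s lam ↔ (∀ c, Dn e (X (K c) (lam c))) ∧
      ∀ c d, c ≤ d → ∀ i, nn e (X (K c) (lam c)) i ≤ nn e (X (K d) (lam d)) i ∧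
        nn e (X (K d) (lam d)) i ≤ nn e (X (K c) (lam c)) i + 1 := by
  have he : 0 < e := Nat.pos_of_ne_zero (NeZero.ne e)
  have hm := fun c x => mem_abacus (K c) (lam c) (s c) (M * e) (hs c) (h c) x
  constructor
  · rintro ⟨h1, h2⟩
    have chain : ∀ k : ℕ, ∀ c d : Fin l, (d : ℕ) = c + k →
        abacus (s c) (lam c) ⊆ abacus (s d) (lam d) := by
      intro k
      induction k with
      | zero =>
        intro c d hcd
        have : d = c := Fin.ext (by simpa using hcd)
        rw [this]
      | succ k ih =>
        intro c d hcd
        have hd := d.2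
        let d' : Fin l := ⟨c + k, by omega⟩
        exact (ih c d' rfl).trans (h1 d' d (by simp [d']; omega))
    have sub : ∀ c d : Fin l, c ≤ d → abacus (s c) (lam c) ⊆ abacus (s d) (lam d) := by
      intro c d hcd
      have : (c : ℕ) ≤ d := hcd
      exact chain (d - c) c d (by omega)
    have wrap : ∀ c d : Fin l, ∀ x ∈ abacus (s c) (lam c), x - (e : ℤ) ∈ abacus (s d) (lam d) := by
      intro c d x hx
      let a : Fin l := ⟨l - 1, by omega⟩
      let b : Fin l := ⟨0, by omega⟩
      have hca : c ≤ a := by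
        have := c.2
        show (c : ℕ) ≤ l - 1
        omega
      have hbd : b ≤ d := by
        show 0 ≤ (d : ℕ)
        omega
      exact sub b d hbd (h2 a b rfl rfl (sub c a hca hx))
    have memX : ∀ c (n : ℕ), n ∈ X (K c) (lam c) ↔ ((n : ℤ) - M * e) ∈ abacus (s c) (lam c) := by
      intro c n
      rw [hm]
      constructor
      · intro hn; exact Or.inr ⟨n, hn, by ring⟩
      · rintro (hn | ⟨n', hn', hh⟩)
        · have : (n : ℤ) < 0 := by linarith
          omega
        · have : n = n' := by
            have : (n : ℤ) = n' := by linarith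
            exact_mod_cast this
          rw [this]; exact hn'
    have wrapX : ∀ c d : Fin l, ∀ n ∈ X (K c) (lam c), e ≤ n → n - e ∈ X (K d) (lam d) := by
      intro c d n hn hen
      rw [memX] at hn ⊢
      have := wrap c d _ hn
      rw [Nat.cast_sub hen]
      convert this using 1
      ring
    have hDn : ∀ c, Dn e (X (K c) (lam c)) := fun c x hx hex => wrapX c c x hx hex
    refine ⟨hDn, fun c d hcd i => ⟨?_, ?_⟩⟩
    · apply Finset.card_le_card
      apply Finset.filter_subset_filter
      intro n hn
      rw [memX] at hn ⊢
      exact sub c d hcd hn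
    · by_contra hcon
      push Not at hcon
      set n := nn e (X (K c) (lam c)) i with hn
      have hr := (flush0 (runner e (X (K d) (lam d)) i)).2.2 ((Dn_iff e _).1 (hDn d) i)
      have hr' := (flush0 (runner e (X (K c) (lam c)) i)).2.2 ((Dn_iff e _).1 (hDn c) i)
      rw [card_runner] at hr hr'
      have m1 : n + 1 ∈ runner e (X (K d) (lam d)) i := by
        rw [hr, Finset.mem_range]; exact hcon
      rw [mem_runner] at m1
      have m2 := wrapX d c _ m1 (by rw [mul_add]; omega)
      have : e * (n + 1) + i.val - e = e * n + i.val := by rw [mul_add]; omega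
      rw [this, ← mem_runner, hr', Finset.mem_range, ← hn] at m2
      omega
  · rintro ⟨hD, hn⟩
    constructor
    · intro i j hij x hx
      rw [hm] at hx ⊢
      rcases hx with hx | ⟨n, hnX, hx⟩
      · exact Or.inl hx
      · refine Or.inr ⟨n, ?_, hx⟩
        rw [Dn_mem e _ (hD _)] at hnX ⊢
        have hij' : i ≤ j := by
          show (i : ℕ) ≤ j
          omega
        exact lt_of_lt_of_le hnX (hn i j hij' _).1
    · intro i j hi hj x hx
      rw [Set.mem_setOf_eq]
      rw [hm] at hx ⊢
      rcases hx with hx | ⟨n, hnX, hx⟩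
      · left; linarith [(Nat.cast_nonneg e : (0 : ℤ) ≤ e)]
      · by_cases hne : n < e
        · left
          have : (n : ℤ) < e := by exact_mod_cast hne
          linarith
        · push Not at hne
          refine Or.inr ⟨n - e, ?_, ?_⟩
          · rw [Dn_mem e _ (hD _)] at hnX ⊢
            have hij' : j ≤ i := by
              show (j : ℕ) ≤ i
              omega
            have h3 := (hn j i hij' (n : ZMod e)).2
            have h4 : ((n - e : ℕ) : ZMod e) = n := by
              rw [Nat.cast_sub hne]; simp
            rw [h4]
            have h5 := Nat.div_eq_sub_div he hne
            omega
          · rw [Nat.cast_sub hne, ← hx]; ring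

end BW

/-- for `s ∈ 𝒜̄^l_e`, `𝛌` is a reduced `(e,s)`-core iff its
block `(e,s)`-weight is zero. -/
theorem stmt15 (e l : ℕ) (he : 2 ≤ e) (hl : 1 ≤ l) (s : Fin l → ℤ) (hs : Abar e s)
    (lam : Fin l → Ptn) : Complete e s lam ↔ blockWeight e s lam = 0 := by
  have : NeZero e := ⟨by omega⟩
  choose B hB using fun c => (lam c).eventually_zero
  let M : ℕ := ∑ c, (B c + (s c).natAbs)
  have hM : ∀ c, (B c : ℤ) ≤ s c + M * e := by
    intro c
    have h1 : B c + (s c).natAbs ≤ M :=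
      Finset.single_le_sum (f := fun c => B c + (s c).natAbs) (fun _ _ => Nat.zero_le _)
        (Finset.mem_univ c)
    have h2 : M ≤ M * e := Nat.le_mul_of_pos_right _ (by omega)
    have h3 : ((M * e : ℕ) : ℤ) = M * e := by push_cast; rfl
    omega
  let K : Fin l → ℕ := fun c => (s c + M * e).toNat
  have hK : ∀ c, s c = K c - (M : ℤ) * e := by
    intro c
    have := hM c
    simp only [K]
    rw [Int.toNat_of_nonneg (by linarith [(Nat.cast_nonneg (B c) : (0 : ℤ) ≤ B c)])]
    ring
  have h0 : ∀ c j, K c ≤ j → (lam c).parts j = 0 := by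
    intro c j hj
    apply hB c
    have h1 := hM c
    have h2 := hK c
    have : (B c : ℤ) ≤ K c := by linarith
    omega
  rw [BW.complete_iff e hl K M s lam hK h0, BW.weight_zero e hl K M s lam hs hK h0]
end

section
/- Let e≥2 and s∈ℤ^l. An l-partition 𝛌 is an (e,s)-core if and only if p_{(e,s)}(𝛌)=0. -/
/-! ### Finite sets of natural numbers -/

theorem aux_sum_ge (A : Finset ℕ) :
    ((A.card : ℤ) ^ 2 - A.card ≤ 2 * ∑ y ∈ A, (y : ℤ)) ∧
    (2 * ∑ y ∈ A, (y : ℤ) = (A.card : ℤ) ^ 2 - A.card → A = Finset.range A.card) := by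
  induction A using Finset.induction_on_max with
  | empty => simp
  | insert a s hs ih =>
    obtain ⟨ih1, ih2⟩ := ih
    have hns : a ∉ s := fun h => lt_irrefl _ (hs a h)
    have hcard : s.card ≤ a := by
      have : s ⊆ Finset.range a := fun x hx => Finset.mem_range.2 (hs x hx)
      simpa using Finset.card_le_card this
    have hc : (s.card : ℤ) ≤ a := by exact_mod_cast hcard
    rw [Finset.sum_insert hns, Finset.card_insert_of_notMem hns]
    push_cast
    constructor
    · nlinarith
    · intro h
      have h1 : 2 * ∑ y ∈ s, (y : ℤ) = (s.card : ℤ) ^ 2 - s.card := by nlinarith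
      have h2 : (a : ℤ) = s.card := by nlinarith
      have h3 : a = s.card := by exact_mod_cast h2
      have h4 := ih2 h1
      rw [Finset.range_add_one, ← h4, ← h3]

theorem aux_down (A : Finset ℕ) (h : ∀ q, q + 1 ∈ A → q ∈ A) :
    A = Finset.range A.card := by
  have hd : ∀ k q, q + k ∈ A → q ∈ A := by
    intro k
    induction k with
    | zero => intro q hq; simpa using hq
    | succ k ih => intro q hq; exact ih q (h _ hq)
  apply Finset.eq_of_subset_of_card_le
  · intro q hq
    have : Finset.range (q + 1) ⊆ A := by
      intro x hx
      rw [Finset.mem_range] at hx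
      exact hd (q - x) x (by rwa [show x + (q - x) = q by omega])
    have := Finset.card_le_card this
    rw [Finset.card_range] at this
    exact Finset.mem_range.2 (by omega)
  · simp

theorem aux_sum_range (n : ℕ) :
    2 * ∑ y ∈ Finset.range n, (y : ℤ) = (n : ℤ) ^ 2 - n := by
  induction n with
  | zero => simp
  | succ n ih => rw [Finset.sum_range_succ, mul_add, ih]; push_cast; ring

/-- number of beads on runner `r` -/
def nrun (e : ℕ) (B : Finset ℕ) (r : ℕ) : ℕ := (B.filter (fun y => y % e = r)).card

/-- the set of levels of the beads on runner `r` -/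
def lev (e : ℕ) (B : Finset ℕ) (r : ℕ) : Finset ℕ :=
  (B.filter (fun y => y % e = r)).image (fun y => y / e)

/-- twice the `e`-weight -/
def wt (e : ℕ) (B : Finset ℕ) : ℤ :=
  2 * ∑ y ∈ B, ((y / e : ℕ) : ℤ) -
    ∑ r ∈ Finset.range e, ((nrun e B r : ℤ) ^ 2 - nrun e B r)

theorem lev_inj (e : ℕ) (B : Finset ℕ) (r : ℕ) :
    Set.InjOn (fun y => y / e) (B.filter (fun y => y % e = r) : Set ℕ) := by
  intro x hx y hy hxy
  simp only [Finset.coe_filter, Set.mem_ofPred_eq] at hx hy hxy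
  rw [← Nat.div_add_mod x e, ← Nat.div_add_mod y e, hx.2, hy.2, hxy]

theorem card_lev (e : ℕ) (B : Finset ℕ) (r : ℕ) : (lev e B r).card = nrun e B r :=
  Finset.card_image_of_injOn (lev_inj e B r)

theorem mem_lev (e : ℕ) (B : Finset ℕ) (r q : ℕ) (hr : r < e) :
    q ∈ lev e B r ↔ e * q + r ∈ B := by
  unfold lev
  simp only [Finset.mem_image, Finset.mem_filter]
  constructor
  · rintro ⟨y, ⟨h1, h2⟩, h3⟩
    rw [← h2, ← h3, Nat.div_add_mod]; exact h1
  · intro h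
    refine ⟨e * q + r, ⟨h, ?_⟩, ?_⟩
    · rw [Nat.mul_add_mod, Nat.mod_eq_of_lt hr]
    · rw [Nat.mul_add_div (by omega), Nat.div_eq_of_lt hr]; simp

theorem wt_eq (e : ℕ) (he : 0 < e) (B : Finset ℕ) :
    wt e B = ∑ r ∈ Finset.range e,
      (2 * ∑ y ∈ lev e B r, (y : ℤ) - (((lev e B r).card : ℤ) ^ 2 - (lev e B r).card)) := by
  unfold wt
  rw [Finset.sum_sub_distrib (s := Finset.range e)
    (f := fun r => 2 * ∑ y ∈ lev e B r, (y : ℤ)), ← Finset.mul_sum]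
  simp only [card_lev]
  congr 2
  rw [← Finset.sum_fiberwise_of_maps_to (s := B) (t := Finset.range e) (g := fun y => y % e)
    (fun y _ => Finset.mem_range.2 (Nat.mod_lt _ he))]
  refine Finset.sum_congr rfl fun r _ => ?_
  unfold lev
  rw [Finset.sum_image (lev_inj e B r)]

theorem wt_nonneg (e : ℕ) (he : 0 < e) (B : Finset ℕ) : 0 ≤ wt e B := by
  rw [wt_eq e he]
  exact Finset.sum_nonneg fun r _ => by linarith [(aux_sum_ge (lev e B r)).1]

theorem wt_zero_mem (e : ℕ) (he : 0 < e) (B : Finset ℕ) (h : wt e B = 0) (r q : ℕ)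
    (hr : r < e) : e * q + r ∈ B ↔ q < nrun e B r := by
  rw [wt_eq e he, Finset.sum_eq_zero_iff_of_nonneg
    (fun r _ => by linarith [(aux_sum_ge (lev e B r)).1])] at h
  have h1 := h r (Finset.mem_range.2 hr)
  have h2 := (aux_sum_ge (lev e B r)).2 (by linarith)
  rw [← mem_lev e B r q hr, h2, Finset.mem_range, card_lev]

theorem wt_zero (e : ℕ) (he : 0 < e) (B : Finset ℕ) (h : ∀ y, y + e ∈ B → y ∈ B) :
    wt e B = 0 := by
  rw [wt_eq e he]
  refine Finset.sum_eq_zero fun r hr => ?_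
  rw [Finset.mem_range] at hr
  have h1 := aux_down (lev e B r) (fun q hq => by
    rw [mem_lev e B r _ hr] at hq ⊢
    exact h _ (by rwa [show e * q + r + e = e * (q + 1) + r by ring]))
  have h2 := aux_sum_range (lev e B r).card
  rw [← h1] at h2
  linarith

theorem sum_nrun (e : ℕ) (he : 0 < e) (B : Finset ℕ) :
    ∑ r ∈ Finset.range e, nrun e B r = B.card :=
  (Finset.card_eq_sum_card_fiberwise (f := fun y => y % e) (t := Finset.range e)
    (fun y _ => by simpa using Nat.mod_lt _ he)).symm

theorem nrun_range (e M t r : ℕ) (ht : t < e) (hr : r < e) :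
    nrun e (Finset.range (t + e * M)) r = M + if r < t then 1 else 0 := by
  have he : 0 < e := by omega
  have h0 : wt e (Finset.range (t + e * M)) = 0 :=
    wt_zero e he _ (fun y hy => by simp only [Finset.mem_range] at hy ⊢; omega)
  have hm := fun q => wt_zero_mem e he _ h0 r q hr
  simp only [Finset.mem_range] at hm
  have a1 := hm M
  have a2 : M + 1 ≤ M + 1 := le_rfl
  have a3 := hm (M + 1)
  rw [mul_add] at a3
  have a4 := hm (M - 1)
  generalize nrun e (Finset.range (t + e * M)) r = n at *
  rcases M with _ | M
  · split_ifs <;> simp at * <;> omega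
  · simp only [Nat.add_sub_cancel] at a4
    rw [mul_add] at a1 a4 a3
    split_ifs <;> omega

/-! ### Beads of a partition -/

def beads (p : Ptn) (N : ℕ) : Finset ℕ :=
  (Finset.range N).image (fun a => p.parts a + (N - 1 - a))

theorem beads_inj (p : Ptn) (N : ℕ) :
    Set.InjOn (fun a => p.parts a + (N - 1 - a)) (Finset.range N : Set ℕ) := by
  intro a ha b hb hab
  simp only [Finset.coe_range, Set.mem_Iio] at ha hb hab
  rcases lt_trichotomy a b with h | h | h
  · have := p.antitone' h.le; omega
  · exact h
  · have := p.antitone' h.le; omega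

theorem card_beads (p : Ptn) (N : ℕ) : (beads p N).card = N := by
  unfold beads
  rw [Finset.card_image_of_injOn (beads_inj p N), Finset.card_range]

theorem mem_beads (p : Ptn) (e M t N : ℕ) (hN : N = t + e * M)
    (hz : ∀ n, N ≤ n → p.parts n = 0) (k : ℕ) :
    k ∈ beads p N ↔ (k : ℤ) - (e * M : ℕ) ∈ abacus (t : ℤ) p := by
  unfold beads abacus
  simp only [Finset.mem_image, Finset.mem_range, Set.mem_ofPred_eq]
  constructor
  · rintro ⟨a, ha, h⟩
    exact ⟨a, by omega⟩
  · rintro ⟨j, hj⟩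
    by_cases h : N ≤ j
    · have := hz j h; omega
    · exact ⟨j, by omega, by omega⟩

theorem mem_abacus_neg (p : Ptn) (e M t N : ℕ) (hN : N = t + e * M)
    (hz : ∀ n, N ≤ n → p.parts n = 0) (x : ℤ) (hx : x + (e * M : ℕ) < 0) :
    x ∈ abacus (t : ℤ) p := by
  have h := hz (N + (-1 - (x + (e * M : ℕ))).toNat) (by omega)
  refine ⟨N + (-1 - (x + (e * M : ℕ))).toNat, ?_⟩
  rw [h]; omega

theorem abacus_sub_iff (p p' : Ptn) (e M t t' N N' m : ℕ) (hN : N = t + e * M)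
    (hN' : N' = t' + e * M)
    (hz : ∀ n, N ≤ n → p.parts n = 0) (hz' : ∀ n, N' ≤ n → p'.parts n = 0) :
    (∀ x ∈ abacus (t : ℤ) p, x - (m : ℤ) ∈ abacus (t' : ℤ) p') ↔
      ∀ k, k + m ∈ beads p N → k ∈ beads p' N' := by
  constructor
  · intro h k hk
    rw [mem_beads p e M t N hN hz] at hk
    rw [mem_beads p' e M t' N' hN' hz']
    have := h _ hk
    push_cast at this ⊢
    convert this using 1; ring
  · intro h x hx
    by_cases hneg : x - m + (e * M : ℕ) < 0
    · exact mem_abacus_neg p' e M t' N' hN' hz' _ hneg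
    · have h1 := h (x - m + (e * M : ℕ)).toNat
      rw [mem_beads p e M t N hN hz, mem_beads p' e M t' N' hN' hz'] at h1
      have e1 : (((x - m + (e * M : ℕ)).toNat + m : ℕ) : ℤ) - (e * M : ℕ) = x := by omega
      have e2 : (((x - m + (e * M : ℕ)).toNat : ℕ) : ℤ) - (e * M : ℕ) = x - m := by omega
      rw [e1, e2] at h1
      exact h1 hx

/-! ### Residue counts -/

/-- content of a bead set -/
def Cf (e : ℕ) (B : Finset ℕ) (i : ℕ) : ℤ := ∑ y ∈ B, ((y : ℤ) - i) / (e : ℤ)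

theorem floor_step (e : ℕ) (he : 0 < e) (z : ℤ) :
    (z + 1) / (e : ℤ) - z / (e : ℤ) = if (e : ℤ) ∣ z + 1 then 1 else 0 := by
  have he' : (0 : ℤ) < e := by exact_mod_cast he
  have h1 := Int.emod_nonneg (z + 1) he'.ne'
  have h2 := Int.emod_lt_of_pos (z + 1) he'
  have h3 := Int.mul_ediv_add_emod (z + 1) e
  split_ifs with h
  · have h4 := Int.emod_eq_zero_of_dvd h
    have h5 : z / (e : ℤ) = (z + 1) / e - 1 ∧ z % e = e - 1 :=
      (Int.ediv_emod_unique he').2 ⟨by linarith, by omega, by omega⟩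
    omega
  · have h4 : (z + 1) % e ≠ 0 := fun h' => h (Int.dvd_of_emod_eq_zero h')
    have h5 : z / (e : ℤ) = (z + 1) / e ∧ z % e = (z + 1) % e - 1 :=
      (Int.ediv_emod_unique he').2 ⟨by linarith, by omega, by omega⟩
    omega

theorem Cf_step (e : ℕ) (B : Finset ℕ) (i : ℕ) (hi : i < e) :
    Cf e B i - Cf e B (i + 1) = nrun e B i := by
  unfold Cf nrun
  rw [← Finset.sum_sub_distrib, Finset.card_filter]
  push_cast
  refine Finset.sum_congr rfl fun y _ => ?_
  have h := floor_step e (by omega) ((y : ℤ) - (i + 1))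
  rw [show (y : ℤ) - (i + 1) + 1 = y - i by ring] at h
  rw [h]
  congr 1
  rw [eq_iff_iff]
  constructor
  · intro h
    have h1 : (i : ℤ) ≡ y [ZMOD e] := Int.modEq_iff_dvd.2 h
    have h2 : i ≡ y [MOD e] := (Int.natCast_modEq_iff).1 h1
    rw [← h2, Nat.mod_eq_of_lt hi]
  · intro h
    refine ⟨((y / e : ℕ) : ℤ), ?_⟩
    have := Nat.div_add_mod y e
    rw [h] at this
    zify at this ⊢
    linarith

theorem row_count (e : ℕ) (he : 0 < e) (c : ℤ) (i m : ℕ) :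
    (((Finset.range m).filter (fun b : ℕ => (e : ℤ) ∣ c + b + 1 - i)).card : ℤ) =
      (c + m - i) / (e : ℤ) - (c - i) / (e : ℤ) := by
  induction m with
  | zero => simp
  | succ m ih =>
    have h := floor_step e he (c + m - i)
    rw [show c + m - i + 1 = c + m + 1 - i by ring] at h
    rw [Finset.card_filter] at ih ⊢
    rw [Finset.sum_range_succ]
    push_cast at ih ⊢
    rw [ih, ← h, ← add_assoc]
    ring

theorem resCount_eq_s16 (e l M : ℕ) (he : 0 < e) (t : Fin l → ℕ) (lam : Fin l → Ptn)
    (hz : ∀ j, ∀ n, t j + e * M ≤ n → (lam j).parts n = 0) (i : ℕ) :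
    (resCount e (fun j => (t j : ℤ)) lam (i : ZMod e) : ℤ) =
      ∑ j, (Cf e (beads (lam j) (t j + e * M)) i - Cf e (Finset.range (t j + e * M)) i) := by
  classical
  let F : Finset (Σ _ : Fin l, Σ _ : ℕ, ℕ) :=
    Finset.univ.sigma (fun j => (Finset.range (t j + e * M)).sigma (fun a =>
      (Finset.range ((lam j).parts a)).filter
        (fun b : ℕ => (e : ℤ) ∣ (((t j + e * M - 1 - a : ℕ) : ℤ)) + b + 1 - i)))
  let g : (Σ _ : Fin l, Σ _ : ℕ, ℕ) → ℕ × ℕ × Fin l := fun x => (x.2.1, x.2.2, x.1)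
  have hg : Function.Injective g := by
    rintro ⟨j, a, b⟩ ⟨j', a', b'⟩ h
    simp only [g, Prod.mk.injEq] at h
    obtain ⟨rfl, rfl, rfl⟩ := h
    rfl
  have hset : {x ∈ diag lam | res e (fun j => (t j : ℤ)) x = (i : ZMod e)} = g '' (F : Set _) := by
    ext ⟨a, b, j⟩
    have key : a < t j + e * M → (res e (fun j => (t j : ℤ)) (a, b, j) = (i : ZMod e) ↔
        (e : ℤ) ∣ (((t j + e * M - 1 - a : ℕ) : ℤ)) + b + 1 - i) := by
      intro ha
      unfold res
      rw [← Int.cast_natCast (R := ZMod e) i, eq_comm, ZMod.intCast_eq_intCast_iff_dvd_sub]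
      have : (((t j + e * M - 1 - a : ℕ) : ℤ)) + b + 1 - i = ((b : ℤ) - a + t j - i) + e * M := by
        have : ((t j + e * M - 1 - a : ℕ) : ℤ) = t j + (e * M : ℕ) - 1 - a := by omega
        rw [this]; push_cast; ring
      rw [this, dvd_add_left (dvd_mul_right _ _)]
    simp only [Set.mem_image, Finset.mem_coe, F, g, Finset.mem_sigma, Finset.mem_univ,
      Finset.mem_range, Finset.mem_filter, true_and, diag, Set.mem_ofPred_eq, Prod.mk.injEq]
    constructor
    · rintro ⟨h1, h2⟩
      have ha : a < t j + e * M := by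
        by_contra hcon
        have := hz j a (by omega)
        omega
      exact ⟨⟨j, a, b⟩, ⟨ha, h1, (key ha).1 h2⟩, rfl, rfl, rfl⟩
    · rintro ⟨⟨j', a', b'⟩, ⟨ha, h1, h2⟩, rfl, rfl, rfl⟩
      exact ⟨h1, (key ha).2 h2⟩
  unfold resCount
  rw [hset, Set.ncard_image_of_injective _ hg, Set.ncard_coe_finset]
  simp only [F, Finset.card_sigma]
  push_cast
  refine Finset.sum_congr rfl fun j _ => ?_
  simp only [row_count e he]
  rw [Finset.sum_sub_distrib]
  congr 1
  · unfold Cf beads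
    rw [Finset.sum_image (beads_inj _ _)]
    refine Finset.sum_congr rfl fun a _ => ?_
    push_cast
    congr 1
    ring
  · unfold Cf
    exact Finset.sum_range_reflect (fun y : ℕ => ((y : ℤ) - i) / (e : ℤ)) _

theorem Cf_zero (e : ℕ) (B : Finset ℕ) :
    2 * Cf e B 0 = wt e B + ∑ r ∈ Finset.range e, ((nrun e B r : ℤ) ^ 2 - nrun e B r) := by
  unfold Cf wt
  simp

theorem Cf_t (e : ℕ) (B : Finset ℕ) (t : ℕ) (ht : t ≤ e) :
    Cf e B t = Cf e B 0 - ∑ r ∈ Finset.range t, (nrun e B r : ℤ) := by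
  induction t with
  | zero => simp
  | succ t ih =>
    have h1 := ih (by omega)
    have h2 := Cf_step e B t (by omega)
    rw [Finset.sum_range_succ]
    linarith

theorem wt_range (e : ℕ) (he : 0 < e) (N : ℕ) : wt e (Finset.range N) = 0 :=
  wt_zero e he _ (fun y hy => by simp only [Finset.mem_range] at hy ⊢; omega)

theorem D_eq (e M t t' : ℕ) (ht' : t' < e) (B : Finset ℕ)
    (hB : B.card = t + e * M) :
    2 * (Cf e B t' - Cf e (Finset.range (t + e * M)) t') = wt e B + ∑ r ∈ Finset.range e,
      ((nrun e B r : ℤ) ^ 2 - (nrun e (Finset.range (t + e * M)) r : ℤ) ^ 2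
        - 2 * (nrun e (Finset.range (t' + e * M)) r : ℤ) *
          ((nrun e B r : ℤ) - nrun e (Finset.range (t + e * M)) r)) := by
  have he : 0 < e := by omega
  have a1 := Cf_zero e B
  have a2 := Cf_zero e (Finset.range (t + e * M))
  rw [wt_range e he] at a2
  have a3 : ∑ r ∈ Finset.range e, (nrun e B r : ℤ) = t + e * M := by
    have := sum_nrun e he B
    rw [hB] at this
    exact_mod_cast this
  have a4 : ∑ r ∈ Finset.range e, (nrun e (Finset.range (t + e * M)) r : ℤ) = t + e * M := by
    have := sum_nrun e he (Finset.range (t + e * M))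
    rw [Finset.card_range] at this
    exact_mod_cast this
  have a5 : ∀ g : ℕ → ℤ, ∑ r ∈ Finset.range e,
      (nrun e (Finset.range (t' + e * M)) r : ℤ) * g r =
      M * ∑ r ∈ Finset.range e, g r + ∑ r ∈ Finset.range t', g r := by
    intro g
    have h1 : Finset.range t' = (Finset.range e).filter (fun r => r < t') := by
      ext r; simp only [Finset.mem_range, Finset.mem_filter]; omega
    rw [h1, Finset.sum_filter, Finset.mul_sum, ← Finset.sum_add_distrib]
    refine Finset.sum_congr rfl fun r hr => ?_
    rw [nrun_range e M t' r ht' (Finset.mem_range.1 hr)]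
    push_cast
    split_ifs <;> ring
  have a6 := a5 (fun r => (nrun e B r : ℤ) - nrun e (Finset.range (t + e * M)) r)
  rw [Cf_t e B t' ht'.le, Cf_t e _ t' ht'.le]
  simp only [mul_assoc]
  rw [Finset.sum_sub_distrib, Finset.sum_sub_distrib, ← Finset.mul_sum, a6]
  rw [Finset.sum_sub_distrib] at a1 a2
  rw [Finset.sum_sub_distrib, Finset.sum_sub_distrib, a3, a4]
  rw [a3] at a1
  rw [a4] at a2
  linarith

theorem alg_id (l : ℕ) (n o : Fin l → ℤ) :
    2 * ∑ i, ∑ j, (n j ^ 2 - o j ^ 2 - 2 * o i * (n j - o j)) - 2 * (∑ j, (n j - o j)) ^ 2 =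
      ∑ i, ∑ j, ((n i - n j) ^ 2 - (o i - o j) ^ 2) := by
  have key : ∀ f : Fin l → ℤ, ∑ i, ∑ j, (f i - f j) ^ 2 =
      2 * l * ∑ j, f j ^ 2 - 2 * (∑ j, f j) ^ 2 := by
    intro f
    have : ∀ i j, (f i - f j) ^ 2 = f i ^ 2 + f j ^ 2 - 2 * (f i * f j) := by intros; ring
    simp only [this, Finset.sum_sub_distrib, Finset.sum_add_distrib, ← Finset.mul_sum,
      Finset.sum_const, Finset.card_univ, Fintype.card_fin, nsmul_eq_mul]
    rw [← Finset.sum_mul]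
    ring
  have h1 : ∑ i, ∑ j, ((n i - n j) ^ 2 - (o i - o j) ^ 2) =
    ∑ i, ∑ j, (n i - n j) ^ 2 - ∑ i, ∑ j, (o i - o j) ^ 2 := by
    simp only [Finset.sum_sub_distrib]
  rw [h1, key, key]
  have h2 : ∑ i, ∑ j, (n j ^ 2 - o j ^ 2 - 2 * o i * (n j - o j)) =
      l * (∑ j, n j ^ 2 - ∑ j, o j ^ 2) - 2 * ((∑ i, o i) * ∑ j, (n j - o j)) := by
    simp only [Finset.sum_sub_distrib, mul_assoc, ← Finset.mul_sum,
      Finset.sum_const, Finset.card_univ, Fintype.card_fin, nsmul_eq_mul]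
    rw [← Finset.sum_mul]
    ring
  rw [h2, Finset.sum_sub_distrib]
  ring

/-- The difference energy of a pair of components. -/
def Qf (e M t t' : ℕ) (B B' : Finset ℕ) : ℤ :=
  ∑ r ∈ Finset.range e, (((nrun e B r : ℤ) - nrun e B' r) ^ 2 -
    ((nrun e (Finset.range (t + e * M)) r : ℤ) - nrun e (Finset.range (t' + e * M)) r) ^ 2)

theorem Qf_symm (e M t t' : ℕ) (B B' : Finset ℕ) : Qf e M t t' B B' = Qf e M t' t B' B := by
  unfold Qf
  refine Finset.sum_congr rfl fun r _ => by ring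

theorem Qf_eq (e M t t' : ℕ) (htt : t ≤ t') (ht' : t' < e) (B B' : Finset ℕ)
    (hB : B.card = t + e * M) (hB' : B'.card = t' + e * M) :
    Qf e M t t' B B' = ∑ r ∈ Finset.range e, (((nrun e B' r : ℤ) - nrun e B r) ^ 2 -
      ((nrun e B' r : ℤ) - nrun e B r)) := by
  have he : 0 < e := by omega
  have hs : ∀ C : Finset ℕ, ∑ r ∈ Finset.range e, (nrun e C r : ℤ) = C.card := by
    intro C
    exact_mod_cast sum_nrun e he C
  have h1 : ∑ r ∈ Finset.range e, ((nrun e (Finset.range (t + e * M)) r : ℤ) -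
        nrun e (Finset.range (t' + e * M)) r) ^ 2 =
      ∑ r ∈ Finset.range e, ((nrun e B' r : ℤ) - nrun e B r) := by
    rw [Finset.sum_sub_distrib, hs, hs, hB, hB']
    have : ∑ r ∈ Finset.range e, ((nrun e (Finset.range (t' + e * M)) r : ℤ) -
        nrun e (Finset.range (t + e * M)) r) = ((t' + e * M : ℕ) : ℤ) - (t + e * M : ℕ) := by
      rw [Finset.sum_sub_distrib, hs, hs, Finset.card_range, Finset.card_range]
    rw [← this]
    refine Finset.sum_congr rfl fun r hr => ?_
    rw [Finset.mem_range] at hr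
    rw [nrun_range e M t r (by omega) hr, nrun_range e M t' r ht' hr]
    split_ifs <;> first | omega | (push_cast; ring)
  unfold Qf
  rw [Finset.sum_sub_distrib, h1, ← Finset.sum_sub_distrib]
  refine Finset.sum_congr rfl fun r _ => by ring

theorem sq_sub_nonneg (d : ℤ) : 0 ≤ d ^ 2 - d := by
  rcases le_or_gt d 0 with h | h
  · nlinarith
  · nlinarith

theorem Qf_nonneg (e M t t' : ℕ) (ht : t < e) (ht' : t' < e) (B B' : Finset ℕ)
    (hB : B.card = t + e * M) (hB' : B'.card = t' + e * M) : 0 ≤ Qf e M t t' B B' := by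
  rcases le_total t t' with h | h
  · rw [Qf_eq e M t t' h ht' B B' hB hB']
    exact Finset.sum_nonneg fun r _ => sq_sub_nonneg _
  · rw [Qf_symm, Qf_eq e M t' t h ht B' B hB' hB]
    exact Finset.sum_nonneg fun r _ => sq_sub_nonneg _

/-- interlacing of two bead sets -/
def Interl (e : ℕ) (B B' : Finset ℕ) : Prop :=
  (∀ k, k ∈ B → k ∈ B') ∧ (∀ k, k + e ∈ B' → k ∈ B)

theorem Qf_zero_iff (e M t t' : ℕ) (htt : t ≤ t') (ht' : t' < e) (B B' : Finset ℕ)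
    (hB : B.card = t + e * M) (hB' : B'.card = t' + e * M) (h0 : wt e B = 0)
    (h0' : wt e B' = 0) : Qf e M t t' B B' = 0 ↔ Interl e B B' := by
  have he : 0 < e := by omega
  rw [Qf_eq e M t t' htt ht' B B' hB hB',
    Finset.sum_eq_zero_iff_of_nonneg (fun r _ => sq_sub_nonneg _)]
  have hm := wt_zero_mem e he B h0
  have hm' := wt_zero_mem e he B' h0'
  constructor
  · intro h
    have h2 : ∀ r < e, nrun e B r ≤ nrun e B' r ∧ nrun e B' r ≤ nrun e B r + 1 := by
      intro r hr
      have := h r (Finset.mem_range.2 hr)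
      have h3 : ((nrun e B' r : ℤ) - nrun e B r) * (((nrun e B' r : ℤ) - nrun e B r) - 1) = 0 := by
        linarith
      rcases mul_eq_zero.1 h3 with h4 | h4 <;> omega
    constructor
    · intro k hk
      have hr := Nat.mod_lt k he
      rw [← Nat.div_add_mod k e] at hk ⊢
      rw [hm _ _ hr] at hk
      rw [hm' _ _ hr]
      have := h2 _ hr
      omega
    · intro k hk
      have hr := Nat.mod_lt k he
      rw [show k + e = e * (k / e + 1) + k % e by
        rw [mul_add, mul_one]; have := Nat.div_add_mod k e; omega] at hk
      rw [← Nat.div_add_mod k e]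
      rw [hm' _ _ hr] at hk
      rw [hm _ _ hr]
      have := h2 _ hr
      omega
  · rintro ⟨h1, h2⟩ r hr
    rw [Finset.mem_range] at hr
    have h3 : nrun e B r ≤ nrun e B' r := by
      by_contra hcon
      have := h1 (e * (nrun e B' r) + r) ((hm _ _ hr).2 (by omega))
      rw [hm' _ _ hr] at this
      omega
    have h4 : nrun e B' r ≤ nrun e B r + 1 := by
      by_contra hcon
      have h5 := h2 (e * (nrun e B r) + r)
      rw [hm _ _ hr, show e * (nrun e B r) + r + e = e * (nrun e B r + 1) + r by ring,
        hm' _ _ hr] at h5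
      omega
    have h5 : (nrun e B' r : ℤ) - nrun e B r = 0 ∨ (nrun e B' r : ℤ) - nrun e B r = 1 := by omega
    rcases h5 with h5 | h5 <;> rw [h5] <;> norm_num

theorem weight_formula (e l M : ℕ) (he : 0 < e) (t : Fin l → ℕ) (ht : ∀ j, t j < e)
    (lam : Fin l → Ptn) (hz : ∀ j, ∀ n, t j + e * M ≤ n → (lam j).parts n = 0) :
    4 * blockWeight e (fun j => (t j : ℤ)) lam =
      ((2 * l * ∑ j, wt e (beads (lam j) (t j + e * M)) +
        ∑ i, ∑ j, Qf e M (t i) (t j) (beads (lam i) (t i + e * M))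
          (beads (lam j) (t j + e * M)) : ℤ) : ℚ) := by
  have hrc := resCount_eq_s16 e l M he t lam hz
  set c : ZMod e → ℕ := resCount e (fun j => (t j : ℤ)) lam with hc
  have hshift : ∑ i ∈ Finset.range e, ((c ((i : ℕ) : ZMod e) : ℚ) - c ((i : ZMod e) - 1)) ^ 2 =
      ∑ i ∈ Finset.range e, ((c ((i : ℕ) : ZMod e) : ℚ) - c ((i + 1 : ℕ) : ZMod e)) ^ 2 := by
    have h1 := Finset.sum_range_succ
      (fun i : ℕ => ((c ((i : ℕ) : ZMod e) : ℚ) - c ((i : ZMod e) - 1)) ^ 2) e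
    rw [Finset.sum_range_succ'] at h1
    simp only [Nat.cast_add, Nat.cast_one, add_sub_cancel_right, CharP.cast_eq_zero, Nat.cast_zero] at h1
    have h2 := add_right_cancel h1
    rw [← h2]
    refine Finset.sum_congr rfl fun i _ => ?_
    push_cast
    ring
  have hd : ∀ r ∈ Finset.range e, ((c ((r : ℕ) : ZMod e) : ℤ) - c ((r + 1 : ℕ) : ZMod e)) =
      ∑ j, ((nrun e (beads (lam j) (t j + e * M)) r : ℤ) -
        nrun e (Finset.range (t j + e * M)) r) := by
    intro r hr
    rw [Finset.mem_range] at hr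
    rw [hrc, hrc, ← Finset.sum_sub_distrib]
    refine Finset.sum_congr rfl fun j _ => ?_
    have h1 := Cf_step e (beads (lam j) (t j + e * M)) r hr
    have h2 := Cf_step e (Finset.range (t j + e * M)) r hr
    linarith
  have hbw : 4 * blockWeight e (fun j => (t j : ℤ)) lam =
      ((2 * ∑ i, 2 * (c ((t i : ℕ) : ZMod e) : ℤ) - 2 * ∑ r ∈ Finset.range e,
        ((c ((r : ℕ) : ZMod e) : ℤ) - c ((r + 1 : ℕ) : ZMod e)) ^ 2 : ℤ) : ℚ) := by
    unfold blockWeight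
    rw [← hc, hshift, ← Finset.mul_sum]
    push_cast
    ring
  rw [hbw]
  congr 1
  rw [Finset.sum_congr (s₁ := Finset.range e) rfl
    (fun r hr => congrArg (fun z : ℤ => z ^ 2) (hd r hr))]
  have hsum : ∀ i, 2 * (c ((t i : ℕ) : ZMod e) : ℤ) =
      ∑ j, wt e (beads (lam j) (t j + e * M)) + ∑ r ∈ Finset.range e, ∑ j,
        ((nrun e (beads (lam j) (t j + e * M)) r : ℤ) ^ 2 -
          (nrun e (Finset.range (t j + e * M)) r : ℤ) ^ 2
        - 2 * (nrun e (Finset.range (t i + e * M)) r : ℤ) *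
          ((nrun e (beads (lam j) (t j + e * M)) r : ℤ) -
            nrun e (Finset.range (t j + e * M)) r)) := by
    intro i
    rw [hrc, Finset.mul_sum, Finset.sum_comm (s := Finset.range e), ← Finset.sum_add_distrib]
    refine Finset.sum_congr rfl fun j _ => ?_
    exact D_eq e M (t j) (t i) (ht i) _ (card_beads _ _)
  simp only [hsum]
  have hQ : ∑ i, ∑ j, Qf e M (t i) (t j) (beads (lam i) (t i + e * M))
          (beads (lam j) (t j + e * M)) =
      ∑ r ∈ Finset.range e, ∑ i, ∑ j,
       (((nrun e (beads (lam i) (t i + e * M)) r : ℤ) - nrun e (beads (lam j) (t j + e * M)) r) ^ 2 -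
        ((nrun e (Finset.range (t i + e * M)) r : ℤ) -
          nrun e (Finset.range (t j + e * M)) r) ^ 2) := by
    unfold Qf
    rw [Finset.sum_comm (s := Finset.range e)]
    refine Finset.sum_congr rfl fun i _ => ?_
    rw [Finset.sum_comm]
  rw [hQ]
  simp only [← alg_id]
  rw [Finset.sum_add_distrib, Finset.sum_const, Finset.card_univ, Fintype.card_fin,
    Finset.sum_comm (t := Finset.range e), Finset.sum_sub_distrib (s := Finset.range e),
    ← Finset.mul_sum, ← Finset.mul_sum, nsmul_eq_mul]
  ring

theorem resCount_mod (e l : ℕ) (s : Fin l → ℤ) (lam : Fin l → Ptn) :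
    resCount e s lam = resCount e (fun j => s j % (e : ℤ)) lam := by
  funext i
  unfold resCount res
  congr 1
  ext x
  simp

theorem blockWeight_mod (e l : ℕ) (s : Fin l → ℤ) (lam : Fin l → Ptn) :
    blockWeight e s lam = blockWeight e (fun j => s j % (e : ℤ)) lam := by
  unfold blockWeight
  rw [← resCount_mod]
  simp

/-- `𝛌` is an `(e,s)`-core iff `p_{(e,s)}(𝛌) = 0`. -/
theorem stmt16 (e l : ℕ) (he : 2 ≤ e) (hl : 1 ≤ l) (s : Fin l → ℤ)
    (lam : Fin l → Ptn) : IsCore e s lam ↔ blockWeight e s lam = 0 := by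
  have he0 : 0 < e := by omega
  obtain ⟨t, ht⟩ : ∃ t : Fin l → ℕ, ∀ j, s j % (e : ℤ) = t j :=
    ⟨fun j => (s j % (e : ℤ)).toNat, fun j => by
      have := Int.emod_nonneg (s j) (b := (e : ℤ)) (by omega)
      exact (Int.toNat_of_nonneg this).symm⟩
  have hte : ∀ j, t j < e := fun j => by
    have := Int.emod_lt_of_pos (s j) (b := (e : ℤ)) (by omega)
    have := ht j
    omega
  choose K hK using fun j => (lam j).eventually_zero
  obtain ⟨M, hM⟩ : ∃ M, ∀ j, K j ≤ M :=
    ⟨∑ j, K j, fun j => Finset.single_le_sum (f := K) (fun _ _ => Nat.zero_le _)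
      (Finset.mem_univ j)⟩
  have hz : ∀ j, ∀ n, t j + e * M ≤ n → (lam j).parts n = 0 := by
    intro j n hn
    refine hK j n ?_
    have := hM j
    have : M ≤ e * M := Nat.le_mul_of_pos_left _ he0
    omega
  have hw := weight_formula e l M he0 t hte lam hz
  have hfun : (fun j => s j % (e : ℤ)) = fun j => (t j : ℤ) := funext ht
  rw [blockWeight_mod, hfun]
  set B : Fin l → Finset ℕ := fun j => beads (lam j) (t j + e * M) with hB
  have hBc : ∀ j, (B j).card = t j + e * M := fun j => card_beads _ _
  have hsub : ∀ i j m, (∀ x ∈ abacus (t i : ℤ) (lam i), x - (m : ℕ) ∈ abacus (t j : ℤ) (lam j)) ↔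
      ∀ k, k + m ∈ B i → k ∈ B j := fun i j m =>
    abacus_sub_iff (lam i) (lam j) e M (t i) (t j) _ _ m rfl rfl (hz i) (hz j)
  have hQn : ∀ i j, 0 ≤ Qf e M (t i) (t j) (B i) (B j) := fun i j =>
    Qf_nonneg e M (t i) (t j) (hte i) (hte j) _ _ (hBc i) (hBc j)
  have hWn : ∀ j, 0 ≤ wt e (B j) := fun j => wt_nonneg e he0 _
  have hzero : blockWeight e (fun j => (t j : ℤ)) lam = 0 ↔
      (∀ j, wt e (B j) = 0) ∧ ∀ i j, Qf e M (t i) (t j) (B i) (B j) = 0 := by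
    have hS1 : 0 ≤ ∑ j, wt e (B j) := Finset.sum_nonneg fun j _ => hWn j
    have hS2 : 0 ≤ ∑ i, ∑ j, Qf e M (t i) (t j) (B i) (B j) :=
      Finset.sum_nonneg fun i _ => Finset.sum_nonneg fun j _ => hQn i j
    have hl' : (1 : ℤ) ≤ l := by exact_mod_cast hl
    constructor
    · intro h
      rw [h, mul_zero] at hw
      have hw' : 2 * (l : ℤ) * ∑ j, wt e (B j) +
        ∑ i, ∑ j, Qf e M (t i) (t j) (B i) (B j) = 0 := by exact_mod_cast hw.symm
      have h1 : ∑ j, wt e (B j) = 0 := by nlinarith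
      have h2 : ∑ i, ∑ j, Qf e M (t i) (t j) (B i) (B j) = 0 := by nlinarith
      rw [Finset.sum_eq_zero_iff_of_nonneg (fun j _ => hWn j)] at h1
      rw [Finset.sum_eq_zero_iff_of_nonneg
        (fun i _ => Finset.sum_nonneg fun j _ => hQn i j)] at h2
      refine ⟨fun j => h1 j (Finset.mem_univ j), fun i j => ?_⟩
      have h3 := h2 i (Finset.mem_univ i)
      rw [Finset.sum_eq_zero_iff_of_nonneg (fun j _ => hQn i j)] at h3
      exact h3 j (Finset.mem_univ j)
    · rintro ⟨h1, h2⟩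
      have : 4 * blockWeight e (fun j => (t j : ℤ)) lam = 0 := by
        rw [hw]
        simp only [hB] at h1 h2
        simp [h1, h2]
      linarith
  rw [hzero]
  have hsort : ∀ i j : Fin l, i ≤ j → t (sigmaPerm e s i) ≤ t (sigmaPerm e s j) := by
    intro i j hij
    have := Tuple.monotone_sort (fun i => s i % (e : ℤ)) hij
    have h2 : s (sigmaPerm e s i) % (e : ℤ) ≤ s (sigmaPerm e s j) % (e : ℤ) := this
    rw [ht, ht] at h2
    exact_mod_cast h2
  have hcore : IsCore e s lam ↔
      (∀ i j : Fin l, (j : ℕ) = (i : ℕ) + 1 →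
        ∀ k, k ∈ B (sigmaPerm e s i) → k ∈ B (sigmaPerm e s j)) ∧
      (∀ i j : Fin l, (i : ℕ) = l - 1 → (j : ℕ) = 0 →
        ∀ k, k + e ∈ B (sigmaPerm e s i) → k ∈ B (sigmaPerm e s j)) := by
    unfold IsCore Complete
    simp only [ht]
    refine and_congr ?_ ?_
    · refine forall_congr' fun i => forall_congr' fun j => imp_congr_right fun _ => ?_
      have := hsub (sigmaPerm e s i) (sigmaPerm e s j) 0
      simpa [Set.subset_def] using this
    · refine forall_congr' fun i => forall_congr' fun j => imp_congr_right fun _ =>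
        imp_congr_right fun _ => ?_
      exact hsub (sigmaPerm e s i) (sigmaPerm e s j) e
  rw [hcore]
  constructor
  · rintro ⟨h1, h2⟩
    have hmono : ∀ n, ∀ i j : Fin l, (j : ℕ) = i + n →
        ∀ k, k ∈ B (sigmaPerm e s i) → k ∈ B (sigmaPerm e s j) := by
      intro n
      induction n with
      | zero =>
        intro i j hij k hk
        have : j = i := Fin.ext (by omega)
        rwa [this]
      | succ n ih =>
        intro i j hij k hk
        have hj := j.2
        exact h1 ⟨i + n, by omega⟩ j (by simp only []; omega) k (ih i ⟨i + n, by omega⟩ rfl k hk)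
    have hI : ∀ i j : Fin l, i ≤ j → Interl e (B (sigmaPerm e s i)) (B (sigmaPerm e s j)) := by
      intro i j hij
      have hij' : (i : ℕ) ≤ j := hij
      have hj := j.2
      refine ⟨hmono (j - i) i j (by omega), fun k hk => ?_⟩
      have a1 := hmono (l - 1 - j) j ⟨l - 1, by omega⟩ (by simp only []; omega) _ hk
      have a2 := h2 ⟨l - 1, by omega⟩ ⟨0, by omega⟩ rfl rfl k a1
      exact hmono i ⟨0, by omega⟩ i (by simp) k a2
    have hW : ∀ j, wt e (B j) = 0 := by
      intro j
      have := (hI ((sigmaPerm e s).symm j) _ le_rfl).2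
      simp only [Equiv.apply_symm_apply] at this
      exact wt_zero e he0 _ this
    refine ⟨hW, ?_⟩
    have hQ : ∀ i j : Fin l, i ≤ j → Qf e M (t (sigmaPerm e s i)) (t (sigmaPerm e s j))
        (B (sigmaPerm e s i)) (B (sigmaPerm e s j)) = 0 := fun i j hij =>
      (Qf_zero_iff e M _ _ (hsort i j hij) (hte _) _ _ (hBc _) (hBc _) (hW _) (hW _)).2 (hI i j hij)
    intro i j
    rcases le_total ((sigmaPerm e s).symm i) ((sigmaPerm e s).symm j) with h | h
    · have := hQ _ _ h
      simpa only [Equiv.apply_symm_apply] using this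
    · have := hQ _ _ h
      simp only [Equiv.apply_symm_apply] at this
      rw [Qf_symm, this]
  · rintro ⟨hW, hQ⟩
    have hI : ∀ i j : Fin l, i ≤ j → Interl e (B (sigmaPerm e s i)) (B (sigmaPerm e s j)) :=
      fun i j hij => (Qf_zero_iff e M _ _ (hsort i j hij) (hte _) _ _ (hBc _) (hBc _)
        (hW _) (hW _)).1 (hQ _ _)
    refine ⟨fun i j hij => (hI i j ?_).1, fun i j hi hj => (hI j i ?_).2⟩
    · exact Fin.le_def.2 (by omega)
    · exact Fin.le_def.2 (by omega)
end

section
/- Let e≥2 and s∈ℤ^l, and suppose the pair (𝛍,v) is obtained from (𝛌,s) by one elementary operation. Then v_1+…+v_l = s_1+…+s_l, and there exists y∈L_t(τ_{e,s}(𝛌)) with y−e∉L_t(τ_{e,s}(𝛌)) such that L_t(τ_{e,v}(𝛍)) = (L_t(τ_{e,s}(𝛌))∖{y})∪{y−e}, where t=s_1+…+s_l. In particular τ_{e,v}(𝛍) is obtained from τ_{e,s}(𝛌) by removing one rim e-hook, and |τ_{e,v}(𝛍)| = |τ_{e,s}(𝛌)| − e. -/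
theorem h17_rank_eq (lam : Ptn) (N : ℕ) (hN : ∀ n, N ≤ n → lam.parts n = 0) :
    rank₁ lam = ∑ j ∈ Finset.range N, lam.parts j := by
  have hd : diag (fun _ : Fin 1 => lam) =
      ((((Finset.range N).sigma (fun j => Finset.range (lam.parts j))).image
        (fun p : (_ : ℕ) × ℕ => ((p.1, p.2, 0) : ℕ × ℕ × Fin 1)) : Finset _) : Set _) := by
    ext ⟨a, b, c⟩
    simp only [diag, Set.mem_setOf_eq, Finset.coe_image, Set.mem_image, Finset.mem_coe,
      Finset.mem_sigma, Finset.mem_range, Prod.mk.injEq]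
    constructor
    · intro h
      refine ⟨⟨a, b⟩, ⟨?_, h⟩, rfl, rfl, Subsingleton.elim _ _⟩
      by_contra hc
      have := hN a (by simpa using hc)
      omega
    · rintro ⟨⟨a', b'⟩, ⟨_, h2⟩, rfl, rfl, _⟩
      exact h2
  unfold rank₁ rank
  rw [hd, Set.ncard_coe_finset, Finset.card_image_of_injective, Finset.card_sigma]
  · simp
  · rintro ⟨a, b⟩ ⟨a', b'⟩ h
    simp only [Prod.mk.injEq] at h
    obtain ⟨rfl, rfl, _⟩ := h
    rfl

/-- The first `N` beads. -/
def h17_beads (t : ℤ) (lam : Ptn) (N : ℕ) : Finset ℤ :=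
  (Finset.range N).image (fun j : ℕ => (lam.parts j : ℤ) - ((j : ℤ) + 1) + t)

theorem h17_mem_beads (t : ℤ) (lam : Ptn) (N : ℕ) (hN : ∀ n, N ≤ n → lam.parts n = 0) (x : ℤ) :
    x ∈ h17_beads t lam N ↔ x ∈ abacus t lam ∧ t - N ≤ x := by
  simp only [h17_beads, Finset.mem_image, Finset.mem_range, abacus, Set.mem_setOf_eq]
  constructor
  · rintro ⟨j, hj, rfl⟩
    exact ⟨⟨j, rfl⟩, by omega⟩
  · rintro ⟨⟨j, rfl⟩, hx⟩
    refine ⟨j, ?_, rfl⟩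
    by_contra hc
    have := hN j (by omega)
    omega

theorem h17_sum_beads (t : ℤ) (lam : Ptn) (N : ℕ) (hN : ∀ n, N ≤ n → lam.parts n = 0) :
    ∑ x ∈ h17_beads t lam N, x =
      (rank₁ lam : ℤ) + ∑ j ∈ Finset.range N, (t - ((j : ℤ) + 1)) := by
  rw [h17_rank_eq lam N hN, h17_beads, Finset.sum_image]
  · push_cast
    rw [← Finset.sum_add_distrib]
    exact Finset.sum_congr rfl (fun j _ => by ring)
  · intro a _ b _ h
    simp only at h
    rcases lt_trichotomy a b with hab | hab | hab
    · have := lam.antitone' hab.le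
      omega
    · exact hab
    · have := lam.antitone' hab.le
      omega

theorem h17_rank_hook (e : ℕ) (t : ℤ) (lam mu : Ptn) (y : ℤ) (hy : y ∈ abacus t lam)
    (hye : y - (e : ℤ) ∉ abacus t lam)
    (h : abacus t mu = (abacus t lam \ {y}) ∪ {y - (e : ℤ)}) :
    (rank₁ mu : ℤ) = (rank₁ lam : ℤ) - (e : ℤ) := by
  obtain ⟨N1, h1⟩ := lam.eventually_zero
  obtain ⟨N2, h2⟩ := mu.eventually_zero
  obtain ⟨N, a1, a2, a3⟩ : ∃ N : ℕ, N1 ≤ N ∧ N2 ≤ N ∧ t - N ≤ y - e :=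
    ⟨N1 + N2 + (t - (y - e)).toNat, by omega, by omega, by omega⟩
  have g1 : ∀ n, N ≤ n → lam.parts n = 0 := fun n hn => h1 n (by omega)
  have g2 : ∀ n, N ≤ n → mu.parts n = 0 := fun n hn => h2 n (by omega)
  have hb : h17_beads t mu N = insert (y - (e : ℤ)) ((h17_beads t lam N).erase y) := by
    ext x
    rw [h17_mem_beads t mu N g2, Finset.mem_insert, Finset.mem_erase, h17_mem_beads t lam N g1, h]
    simp only [Set.mem_union, Set.mem_diff, Set.mem_singleton_iff]
    constructor
    · rintro ⟨⟨p, q⟩ | p, r⟩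
      · exact Or.inr ⟨q, p, r⟩
      · exact Or.inl p
    · rintro (p | ⟨p, q, r⟩)
      · exact ⟨Or.inr p, by omega⟩
      · exact ⟨Or.inl ⟨q, p⟩, r⟩
  have hs : ∑ x ∈ h17_beads t mu N, x = (y - e) + (∑ x ∈ h17_beads t lam N, x - y) := by
    rw [hb, Finset.sum_insert]
    · have hm : y ∈ h17_beads t lam N := (h17_mem_beads t lam N g1 y).2 ⟨hy, by omega⟩
      have := Finset.add_sum_erase (h17_beads t lam N) (fun x => x) hm
      linarith
    · intro hc
      exact hye ((h17_mem_beads t lam N g1 _).1 (Finset.mem_of_mem_erase hc)).1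
  rw [h17_sum_beads t mu N g2, h17_sum_beads t lam N g1] at hs
  linarith

/-- The Uglov relabelling of beads. -/
def h17_U (e l : ℕ) (p : Fin l × ℤ) : ℤ :=
  ((l : ℤ) - 1 - ((p.1 : ℕ) : ℤ)) * (e : ℤ) + (p.2 / e) * (e : ℤ) * (l : ℤ) + p.2 % e

theorem h17_U_inj (e l : ℕ) (he : 2 ≤ e) : Function.Injective (h17_U e l) := by
  rintro ⟨c, x⟩ ⟨c', x'⟩ h
  have he0 : (0 : ℤ) < e := by omega
  have key : ∀ (c : Fin l) (x : ℤ), h17_U e l (c, x) % e = x % e ∧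
      h17_U e l (c, x) / e / l = x / e ∧ h17_U e l (c, x) / e % l = (l : ℤ) - 1 - (c : ℕ) := by
    intro c x
    have hE : h17_U e l (c, x) = x % e + e * (((l : ℤ) - 1 - (c : ℕ)) + l * (x / e)) := by
      simp only [h17_U]; ring
    have hc := c.2
    have hl0 : (l : ℤ) ≠ 0 := by omega
    have hd : h17_U e l (c, x) / e = ((l : ℤ) - 1 - (c : ℕ)) + l * (x / e) := by
      rw [hE, Int.add_mul_ediv_left _ _ he0.ne',
        Int.ediv_eq_zero_of_lt (Int.emod_nonneg _ he0.ne') (Int.emod_lt_of_pos _ he0), zero_add]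
    refine ⟨?_, ?_, ?_⟩
    · rw [hE, Int.add_mul_emod_self_left, Int.emod_emod]
    · rw [hd, Int.add_mul_ediv_left _ _ hl0, Int.ediv_eq_zero_of_lt (by omega) (by omega), zero_add]
    · rw [hd, Int.add_mul_emod_self_left, Int.emod_eq_of_lt (by omega) (by omega)]
  obtain ⟨a1, a2, a3⟩ := key c x
  obtain ⟨b1, b2, b3⟩ := key c' x'
  rw [h] at a1 a2 a3
  have hx : x = x' := by
    rw [← Int.emod_add_mul_ediv x e, ← Int.emod_add_mul_ediv x' e, ← a1, ← a2, b1, b2]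
  have hc : c = c' := by
    apply Fin.ext
    omega
  rw [hx, hc]

theorem h17_uglov (e : ℕ) {l : ℕ} (he : 2 ≤ e) (s : Fin l → ℤ) (lam : Fin l → Ptn) :
    uglovSet e s lam = h17_U e l '' {p | p.2 ∈ abacus (s p.1) (lam p.1)} := by
  have he0 : (0 : ℤ) < e := by omega
  ext y
  simp only [uglovSet, Set.mem_setOf_eq, Set.mem_image, Prod.exists]
  constructor
  · rintro ⟨c, q, r, hr, hm, rfl⟩
    refine ⟨c, _, hm, ?_⟩
    have h1 : (q * (e : ℤ) + r) / e = q := by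
      rw [add_comm, Int.add_mul_ediv_right _ _ he0.ne',
        Int.ediv_eq_zero_of_lt (by omega) (by omega), zero_add]
    have h2 : (q * (e : ℤ) + r) % e = r := by
      rw [add_comm, Int.add_mul_emod_self_right, Int.emod_eq_of_lt (by omega) (by omega)]
    simp only [h17_U, h1, h2]
  · rintro ⟨c, x, hm, rfl⟩
    have h0 := Int.emod_nonneg x he0.ne'
    have h1 := Int.emod_lt_of_pos x he0
    have h2 : (((x % e).toNat : ℕ) : ℤ) = x % e := Int.toNat_of_nonneg h0
    refine ⟨c, x / e, (x % e).toNat, by omega, ?_, ?_⟩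
    · rw [h2, mul_comm, Int.mul_ediv_add_emod]
      exact hm
    · rw [h2]
      rfl

theorem h17_sum_charge {l : ℕ} (s v : Fin l → ℤ) (i j : Fin l) (hij : i ≠ j)
    (hi : v i = s i - 1) (hj : v j = s j + 1) (hk : ∀ k, k ≠ i → k ≠ j → v k = s k) :
    ∑ k, v k = ∑ k, s k := by
  have : v = fun k => s k + (Pi.single j 1 - Pi.single i 1 : Fin l → ℤ) k := by
    funext k
    by_cases h1 : k = i
    · subst h1
      simp [hi, hij]
      ring
    · by_cases h2 : k = j
      · subst h2
        simp [hj, h1]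
      · simp [hk k h1 h2, h1, h2]
  rw [this, Finset.sum_add_distrib]
  simp

/-- Common form of all elementary operations. -/
theorem h17_op (e l : ℕ) (hl : 1 ≤ l) (he : 2 ≤ e) (lam mu : Fin l → Ptn)
    (s v : Fin l → ℤ) (hop : ElemOp e (lam, s) (mu, v)) :
    (∑ i, v i) = (∑ i, s i) ∧ ∃ (i j : Fin l) (x x' : ℤ),
      h17_U e l (j, x') = h17_U e l (i, x) - e ∧
      x ∈ abacus (s i) (lam i) ∧ x' ∉ abacus (s j) (lam j) ∧
      {p : Fin l × ℤ | p.2 ∈ abacus (v p.1) (mu p.1)} =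
        ({p : Fin l × ℤ | p.2 ∈ abacus (s p.1) (lam p.1)} \ {(i, x)}) ∪ {(j, x')} := by
  have he0 : (0 : ℤ) < e := by omega
  have gen : ∀ (i j : Fin l) (x x' : ℤ), i ≠ j →
      abacus (v i) (mu i) = abacus (s i) (lam i) \ {x} →
      abacus (v j) (mu j) = abacus (s j) (lam j) ∪ {x'} →
      (∀ k, k ≠ i → k ≠ j → mu k = lam k ∧ v k = s k) →
      {p : Fin l × ℤ | p.2 ∈ abacus (v p.1) (mu p.1)} =
        ({p : Fin l × ℤ | p.2 ∈ abacus (s p.1) (lam p.1)} \ {(i, x)}) ∪ {(j, x')} := by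
    intro i j x x' hij h1 h2 h3
    ext ⟨k, z⟩
    simp only [Set.mem_setOf_eq, Set.mem_union, Set.mem_diff, Set.mem_singleton_iff,
      Prod.mk.injEq]
    by_cases hki : k = i
    · subst hki
      rw [h1]
      simp [hij]
    · by_cases hkj : k = j
      · subst hkj
        rw [h2]
        simp [hki, or_comm]
      · obtain ⟨q1, q2⟩ := h3 k hki hkj
        rw [q1, q2]
        simp [hki, hkj]
  rcases hop with ⟨i, j, x, hij, h1, h2, h3, h4, h5, h6, h7⟩ |
    ⟨i, j, x, hi, hj, h1, h2, h3, h4, h5⟩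
  · simp only at h1 h2 h3 h4 h5 h6 h7
    have hne : i ≠ j := by
      rintro rfl
      omega
    refine ⟨h17_sum_charge s v i j hne h5 h6 (fun k a b => (h7 k a b).2), i, j, x, x, ?_, h1, h2,
      gen i j x x hne h3 h4 h7⟩
    simp only [h17_U, hij]
    push_cast
    ring
  · simp only at h1 h2 h3 h4 h5
    have hU : h17_U e l (j, x - e) = h17_U e l (i, x) - e := by
      have d1 : (x - e) / (e : ℤ) = x / e - 1 := by
        have := Int.add_mul_ediv_right x (-1) he0.ne'
        rw [← sub_eq_add_neg] at this
        rw [← this]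
        congr 1
        ring
      have d2 : (x - e) % (e : ℤ) = x % e := by simp
      have hi' : ((i : ℕ) : ℤ) = l - 1 := by omega
      simp only [h17_U, d1, d2, hi', hj]
      push_cast
      ring
    by_cases hne : i = j
    · obtain ⟨g1, g2⟩ := h3 hne
      subst hne
      refine ⟨?_, i, i, x, x - e, hU, h1, h2, ?_⟩
      · refine Finset.sum_congr rfl (fun k _ => ?_)
        by_cases hk : k = i
        · rw [hk, g2]
        · exact (h5 k hk hk).2
      · ext ⟨k, z⟩
        simp only [Set.mem_setOf_eq, Set.mem_union, Set.mem_diff, Set.mem_singleton_iff,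
          Prod.mk.injEq]
        by_cases hk : k = i
        · subst hk
          rw [g1]
          simp [or_comm]
        · obtain ⟨q1, q2⟩ := h5 k hk hk
          rw [q1, q2]
          simp [hk]
    · obtain ⟨g1, g2, g3, g4⟩ := h4 hne
      exact ⟨h17_sum_charge s v i j hne g3 g4 (fun k a b => (h5 k a b).2), i, j, x, x - e, hU,
        h1, h2, gen i j x (x - e) hne g1 g2 h5⟩

/-- an elementary operation preserves the sum of the multicharge and
corresponds to removing one rim `e`-hook from the image under the Uglov map. -/
theorem stmt17 (e l : ℕ) (he : 2 ≤ e) (hl : 1 ≤ l) (lam mu : Fin l → Ptn)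
    (s v : Fin l → ℤ) (hop : ElemOp e (lam, s) (mu, v)) :
    (∑ i, v i) = (∑ i, s i) ∧
    ∀ tlam tmu : Ptn, IsUglov e s lam tlam → IsUglov e v mu tmu →
      (∃ y ∈ abacus (∑ i, s i) tlam, y - (e : ℤ) ∉ abacus (∑ i, s i) tlam ∧
        abacus (∑ i, s i) tmu =
          (abacus (∑ i, s i) tlam \ {y}) ∪ {y - (e : ℤ)}) ∧
      (rank₁ tmu : ℤ) = (rank₁ tlam : ℤ) - (e : ℤ) := by
  obtain ⟨hsum, i, j, x, x', hU, hx, hx', hP⟩ := h17_op e l hl he lam mu s v hop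
  refine ⟨hsum, fun tlam tmu hl1 hm1 => ?_⟩
  have inj := h17_U_inj e l he
  unfold IsUglov at hl1 hm1
  rw [h17_uglov e he] at hl1 hm1
  rw [hsum, hP, Set.image_union, Set.image_diff inj, Set.image_singleton, Set.image_singleton, hU,
    ← hl1] at hm1
  have hy : h17_U e l (i, x) ∈ abacus (∑ i, s i) tlam := by
    rw [hl1]
    exact ⟨(i, x), hx, rfl⟩
  have hye : h17_U e l (i, x) - e ∉ abacus (∑ i, s i) tlam := by
    rw [hl1, ← hU]
    rintro ⟨p, hp, hpe⟩
    have := inj hpe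
    subst this
    exact hx' hp
  exact ⟨⟨_, hy, hye, hm1⟩, h17_rank_hook e _ tlam tmu _ hy hye hm1⟩
end
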